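/- arXiv:1807.04251 — 4 statements merged into one kernel-verified Lean document; each statement's English description precedes it below -/
import Mathlib

section
/- The series Σ_{i=0}^∞ b_i converges and its sum equals 0; consequently, for every k ≥ 1 the partial sum s_k := Σ_{i=0}^{k−1} b_i equals Σ_{i=k}^∞ (−b_i) and satisfies 0 < s_k ≤ 1. -/
/-- The series Σ b_i converges with sum 0; consequently, for every k ≥ 1 the partial sum
s_k = Σ_{i=0}^{k−1} b_i equals Σ_{i=k}^∞ (−b_i) and satisfies 0 < s_k ≤ 1. -/
theorem binomial_coeff_sum_zero
    (p : ℕ) (hp : 2 ≤ p)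
    (b : ℕ → ℝ)
    (hb : ∀ i, b i = (∏ j ∈ Finset.range i, ((j : ℝ) - 1 / p)) / (Nat.factorial i : ℝ)) :
    HasSum b 0 ∧
    ∀ k, 1 ≤ k →
      HasSum (fun i => -b (k + i)) (∑ i ∈ Finset.range k, b i) ∧
      0 < ∑ i ∈ Finset.range k, b i ∧
      (∑ i ∈ Finset.range k, b i) ≤ 1 := by
  have hp' : (2 : ℝ) ≤ p := by exact_mod_cast hp
  obtain ⟨a, ha⟩ : ∃ a : ℝ, a = 1 / p := ⟨_, rfl⟩
  have ha0 : 0 < a := by rw [ha]; positivity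
  have ha1 : a < 1 := by
    rw [ha, div_lt_one (by linarith)]; linarith
  rw [← ha] at hb
  have b0 : b 0 = 1 := by simp [hb]
  have hrec : ∀ k : ℕ, b (k + 1) = b k * (((k : ℝ) - a) / (k + 1)) := by
    intro k
    rw [hb, hb, Finset.prod_range_succ, Nat.factorial_succ]
    have : (Nat.factorial k : ℝ) ≠ 0 := by positivity
    have : (k : ℝ) + 1 ≠ 0 := by positivity
    push_cast
    field_simp
  have hbs : ∀ k : ℕ, b (k + 1) = -(a / (k + 1)) * ∑ i ∈ Finset.range (k + 1), b i := by
    intro k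
    induction k with
    | zero => simp [hrec 0, b0]
    | succ n ih =>
      rw [Finset.sum_range_succ, hrec (n + 1)]
      have h1 : (n : ℝ) + 1 ≠ 0 := by positivity
      have h2 : (n : ℝ) + 1 + 1 ≠ 0 := by positivity
      have h3 : a * ∑ i ∈ Finset.range (n + 1), b i = -((n : ℝ) + 1) * b (n + 1) := by
        rw [ih]; field_simp
      push_cast
      field_simp
      linear_combination h3
  have hs : ∀ k : ℕ, 0 < ∑ i ∈ Finset.range (k + 1), b i ∧
      ∑ i ∈ Finset.range (k + 1), b i ≤
        Real.exp (-(a * ∑ i ∈ Finset.range k, 1 / ((i : ℝ) + 1))) := by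
    intro k
    induction k with
    | zero => simp [b0]
    | succ n ih =>
      have e : ∑ i ∈ Finset.range (n + 1 + 1), b i
          = (∑ i ∈ Finset.range (n + 1), b i) * (1 - a / (n + 1)) := by
        rw [Finset.sum_range_succ, hbs n]; ring
      have hpos : 0 < 1 - a / ((n : ℝ) + 1) := by
        rw [sub_pos, div_lt_one (by positivity)]
        have : (0 : ℝ) ≤ n := by positivity
        linarith
      rw [e]
      refine ⟨mul_pos ih.1 hpos, ?_⟩
      rw [Finset.sum_range_succ (fun i : ℕ => 1 / ((i : ℝ) + 1)), mul_add, neg_add, Real.exp_add]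
      refine mul_le_mul ih.2 ?_ hpos.le (Real.exp_pos _).le
      have := Real.add_one_le_exp (-(a * (1 / ((n : ℝ) + 1))))
      rw [mul_one_div] at this ⊢
      linarith
  have hneg : ∀ k : ℕ, 0 ≤ -b (k + 1) := by
    intro k
    rw [hbs k]
    have := (hs k).1
    have : 0 ≤ (a / ((k : ℝ) + 1)) * ∑ i ∈ Finset.range (k + 1), b i := by positivity
    linarith
  have hlim : Filter.Tendsto (fun k => ∑ i ∈ Finset.range (k + 1), b i) Filter.atTop (nhds 0) := by
    refine squeeze_zero (fun k => (hs k).1.le) (fun k => (hs k).2) ?_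
    refine Real.tendsto_exp_atBot.comp (Filter.tendsto_neg_atTop_atBot.comp ?_)
    exact Real.tendsto_sum_range_one_div_nat_succ_atTop.const_mul_atTop ha0
  have htail : HasSum (fun i => -b (i + 1)) 1 := by
    rw [hasSum_iff_tendsto_nat_of_nonneg hneg]
    have := hlim.const_sub 1
    rw [sub_zero] at this
    refine this.congr fun k => ?_
    rw [Finset.sum_range_succ', b0, Finset.sum_neg_distrib]
    ring
  have hsum : HasSum b 0 := by
    have h := htail.neg
    simp only [neg_neg] at h
    have := (hasSum_nat_add_iff (f := b) 1).1 h
    simpa [b0] using this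
  refine ⟨hsum, fun k hk => ⟨?_, ?_, ?_⟩⟩
  · have h : HasSum (fun i => b (i + k)) (-∑ i ∈ Finset.range k, b i) := by
      rw [hasSum_nat_add_iff]
      simpa using hsum
    have h' := h.neg
    rw [neg_neg] at h'
    simpa only [add_comm k] using h'
  · obtain ⟨n, rfl⟩ := Nat.exists_eq_add_of_le' hk
    exact (hs n).1
  · obtain ⟨n, rfl⟩ := Nat.exists_eq_add_of_le' hk
    refine (hs n).2.trans (Real.exp_le_one_iff.2 ?_)
    have : 0 ≤ a * ∑ i ∈ Finset.range n, 1 / ((i : ℝ) + 1) := by positivity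
    linarith
end

section
/- Let N be a submultiplicative matrix norm on the n×n complex matrices, i.e. N(X) ≥ 0 with N(X) = 0 iff X = 0, N(cX) = |c|·N(X) for c ∈ ℂ, N(X + Y) ≤ N(X) + N(Y), and N(XY) ≤ N(X)·N(Y), and suppose N(B) < 1. Then the family (b_i·B^i)_{i∈ℕ} is summable; writing A^{1/p} := Σ_{i=0}^∞ b_i·B^i and s_j := Σ_{i=0}^{j−1} b_i, for every k ≥ 0 one has N(X_k − A^{1/p}) ≤ s_{(m+1)^k}·N(B)^{(m+1)^k} ≤ N(B)^{(m+1)^k}. -/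
open PowerSeries in
/-- All coefficients of the series are nonnegative. -/
def SchrNn (φ : PowerSeries ℝ) : Prop := ∀ i, 0 ≤ coeff i φ

namespace SchrNn
open PowerSeries

theorem mul {φ ψ : PowerSeries ℝ} (h1 : SchrNn φ) (h2 : SchrNn ψ) : SchrNn (φ * ψ) := by
  intro i
  rw [coeff_mul]
  exact Finset.sum_nonneg fun x _ => mul_nonneg (h1 _) (h2 _)

theorem add {φ ψ : PowerSeries ℝ} (h1 : SchrNn φ) (h2 : SchrNn ψ) : SchrNn (φ + ψ) := by
  intro i
  rw [map_add]
  exact add_nonneg (h1 _) (h2 _)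

theorem one : SchrNn (1 : PowerSeries ℝ) := by
  intro i
  rw [coeff_one]
  split_ifs <;> norm_num

theorem pow {φ : PowerSeries ℝ} (h : SchrNn φ) (n : ℕ) : SchrNn (φ ^ n) := by
  induction n with
  | zero => rw [pow_zero]; exact one
  | succ n ih => rw [pow_succ]; exact ih.mul h

theorem subst {f φ : PowerSeries ℝ} (hf : HasSubst f) (h1 : SchrNn f) (h2 : SchrNn φ) :
    SchrNn (PowerSeries.subst f φ : PowerSeries ℝ) := by
  intro i
  rw [coeff_subst' hf]
  exact finsum_nonneg fun d => mul_nonneg (h2 d) (h1.pow d i)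

/-- The recursion for the inverse of a series with constant coefficient one. -/
theorem inv_rec {u : PowerSeries ℝ} (h0 : constantCoeff u = 1) (n : ℕ) :
    coeff (n + 1) u⁻¹ =
      ∑ x ∈ Finset.HasAntidiagonal.antidiagonal n, (-coeff (x.1 + 1) u) * coeff x.2 u⁻¹ := by
  have h : u * u⁻¹ = 1 := PowerSeries.mul_inv_cancel u (by rw [h0]; norm_num)
  have h' := congrArg (coeff (n + 1)) h
  rw [coeff_mul, Finset.Nat.antidiagonal_succ, Finset.sum_cons, Finset.sum_map, coeff_one] at h'
  simp [h0] at h'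
  simp only [neg_mul, Finset.sum_neg_distrib]
  linarith

theorem inv {u : PowerSeries ℝ} (h0 : constantCoeff u = 1) (h : ∀ i, coeff (i + 1) u ≤ 0) :
    SchrNn u⁻¹ := by
  intro i
  induction i using Nat.strong_induction_on with
  | _ i ih =>
    cases i with
    | zero => simp [h0]
    | succ n =>
      rw [inv_rec h0]
      refine Finset.sum_nonneg fun x hx => mul_nonneg (by linarith [h x.1]) (ih _ ?_)
      have := Finset.HasAntidiagonal.mem_antidiagonal.1 hx
      omega

theorem inv_le {u : PowerSeries ℝ} (h0 : constantCoeff u = 1) (h : ∀ i, coeff (i + 1) u ≤ 0)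
    (hs : ∀ n, ∑ i ∈ Finset.range n, -coeff (i + 1) u ≤ 1) (i : ℕ) : coeff i u⁻¹ ≤ 1 := by
  induction i using Nat.strong_induction_on with
  | _ i ih =>
    cases i with
    | zero => simp [h0]
    | succ n =>
      rw [inv_rec h0]
      refine le_trans (Finset.sum_le_sum (g := fun x => -coeff (x.1 + 1) u) fun x hx => ?_) ?_
      · have := Finset.HasAntidiagonal.mem_antidiagonal.1 hx
        have h1 := ih x.2 (by omega)
        have h2 := h x.1
        nlinarith
      · rw [Finset.Nat.sum_antidiagonal_eq_sum_range_succ_mk]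
        exact hs _

end SchrNn

section
open PowerSeries

theorem schr_deriv_f (w m : ℕ) (c : ℝ) (u : PowerSeries ℝ) (h0 : constantCoeff u = 1)
    (hu : (1 - X) * d⁄dX ℝ u = C c * X ^ m - C (1 / ((w : ℝ) + 2)) * u) :
    d⁄dX ℝ (1 - (1 - X) * u⁻¹ ^ (w + 2)) =
      C (((w : ℝ) + 2) * c) * X ^ m * u⁻¹ ^ (w + 3) := by
  have h : u * u⁻¹ = 1 := PowerSeries.mul_inv_cancel u (by rw [h0]; norm_num)
  have hP : C ((w : ℝ) + 2) * C (1 / ((w : ℝ) + 2)) = (1 : PowerSeries ℝ) := by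
    rw [← map_mul, mul_one_div_cancel (by positivity), map_one]
  simp only [map_sub, Derivation.leibniz, derivative_pow, derivative_inv', derivative_one,
    derivative_X, smul_eq_mul, map_mul]
  set v := u⁻¹
  set D := d⁄dX ℝ u
  set e := C (1 / ((w : ℝ) + 2)) 
  set cc := C c
  have hn : ((w + 2 : ℕ) : PowerSeries ℝ) = C ((w : ℝ) + 2) := by
    rw [← map_natCast C]; push_cast; rfl
  rw [hn]
  simp only [show w + 2 - 1 = w + 1 by omega]
  set P := C ((w : ℝ) + 2)
  linear_combination (P * v ^ (w + 3)) * hu - v ^ (w + 2) * hP - (P * e * v ^ (w+2)) * h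

theorem schr_deriv_g (w m : ℕ) (c : ℝ) (u : PowerSeries ℝ) (h0 : constantCoeff u = 1)
    (hu : (1 - X) * d⁄dX ℝ u = C c * X ^ m - C (1 / ((w : ℝ) + 2)) * u) :
    d⁄dX ℝ (u - (1 - X) * u⁻¹ ^ (w + 1)) =
      d⁄dX ℝ u + (C (1 / ((w : ℝ) + 2)) * u⁻¹ ^ (w + 1)
        + C (((w : ℝ) + 1) * c) * X ^ m * u⁻¹ ^ (w + 2)) := by
  have h : u * u⁻¹ = 1 := PowerSeries.mul_inv_cancel u (by rw [h0]; norm_num)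
  have hP : (C ((w : ℝ) + 1) + 1) * C (1 / ((w : ℝ) + 2)) = (1 : PowerSeries ℝ) := by
    rw [← map_one C, ← map_add, ← map_mul, add_assoc, one_add_one_eq_two,
      mul_one_div_cancel (by positivity)]
  simp only [map_sub, Derivation.leibniz, derivative_pow, derivative_inv', derivative_one,
    derivative_X, smul_eq_mul, map_mul]
  set v := u⁻¹
  set D := d⁄dX ℝ u
  set e := C (1 / ((w : ℝ) + 2)) 
  set cc := C c
  have hn : ((w + 1 : ℕ) : PowerSeries ℝ) = C ((w : ℝ) + 1) := by simp
  rw [hn]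
  simp only [show w + 1 - 1 = w by omega]
  set P := C ((w : ℝ) + 1)
  linear_combination (P * v ^ (w + 2)) * hu - v ^ (w + 1) * hP - (P * e * v ^ (w+1)) * h

theorem schr_root_unique (q : ℕ) (a c : PowerSeries ℝ) (ha : constantCoeff a = 1)
    (hc : constantCoeff c = 1) (h : a ^ (q + 1) = c ^ (q + 1)) : a = c := by
  have h1 := (Commute.all a c).geom_sum₂_mul (q + 1)
  rw [h, sub_self, mul_eq_zero] at h1
  rcases h1 with h1 | h1
  · exfalso
    have h2 := congrArg constantCoeff h1
    simp [ha, hc] at h2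
    have : (0:ℝ) ≤ q := Nat.cast_nonneg q
    linarith
  · exact sub_eq_zero.1 h1

theorem schr_series_main (w m : ℕ) (b : ℕ → ℝ) (hb0 : b 0 = 1) (hbn : ∀ i, b (i + 1) ≤ 0)
    (hrec : ∀ i : ℕ, ((i : ℝ) + 1) * b (i + 1) = ((i : ℝ) - 1 / ((w : ℝ) + 2)) * b i) :
    ∃ x : ℕ → PowerSeries ℝ, x 0 = 1 ∧
      (∀ k, x (k + 1) = x k * ∑ i ∈ Finset.range (m + 1),
        b i • (1 - (1 - X) * (x k)⁻¹ ^ (w + 2)) ^ i) ∧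
      ∀ k, X ^ ((m + 1) ^ k) ∣ x k - mk b ∧ SchrNn (x k - mk b) ∧ SchrNn (1 - x k) ∧
        constantCoeff (x k) = 1 := by
  set β : PowerSeries ℝ := mk b with hβ
  set T : PowerSeries ℝ := ∑ i ∈ Finset.range (m + 1), b i • X ^ i with hT
  have hTc : ∀ i, coeff i T = if i < m + 1 then b i else 0 := by
    intro i
    simp [hT, coeff_X_pow]
  have hβ0 : constantCoeff β = 1 := by
    rw [← coeff_zero_eq_constantCoeff_apply, hβ, coeff_mk, hb0]
  have hT0 : constantCoeff T = 1 := by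
    rw [← coeff_zero_eq_constantCoeff_apply, hTc]; simp [hb0]
  set c : ℝ := -((m + 1 : ℝ) * b (m + 1)) with hc
  have hc0 : 0 ≤ c := by
    have := hbn m
    have : (0:ℝ) ≤ m := Nat.cast_nonneg m
    rw [hc]; nlinarith
  have hβode : (1 - X) * d⁄dX ℝ β = C 0 * X ^ m - C (1 / ((w : ℝ) + 2)) * β := by
    ext i
    rw [sub_mul, one_mul, map_zero, zero_mul, zero_sub, map_sub, map_neg, coeff_C_mul]
    cases i with
    | zero =>
      have := hrec 0
      simp [coeff_derivative, hβ] at this ⊢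
      linarith
    | succ i =>
      have := hrec (i + 1)
      rw [coeff_succ_X_mul]
      simp [coeff_derivative, hβ] at this ⊢
      linarith
  have hTode : (1 - X) * d⁄dX ℝ T = C c * X ^ m - C (1 / ((w : ℝ) + 2)) * T := by
    ext i
    rw [sub_mul, one_mul, map_sub, map_sub, coeff_C_mul, coeff_C_mul, coeff_X_pow]
    have key : coeff i (d⁄dX ℝ T) - coeff i (X * d⁄dX ℝ T) =
        (if i + 1 < m + 1 then b (i + 1) else 0) * (i + 1) -
          (if i < m + 1 then b i else 0) * i := by
      cases i with
      | zero => simp [coeff_derivative, hTc]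
      | succ i =>
        rw [coeff_succ_X_mul, coeff_derivative, coeff_derivative, hTc, hTc]
        push_cast; rfl
    rw [key, hTc]
    have := hrec i
    rcases lt_trichotomy i m with h | h | h
    · rw [if_pos (by omega), if_pos (by omega), if_neg (by omega)]; linarith
    · subst h
      rw [if_neg (by omega), if_pos (by omega), if_pos rfl]
      rw [hc]; linarith
    · rw [if_neg (by omega), if_neg (by omega), if_neg (by omega)]; ring
  have hTn : ∀ i, coeff (i + 1) T ≤ 0 := by
    intro i
    rw [hTc]; split_ifs
    · exact hbn i
    · exact le_rfl
  have hvn : SchrNn T⁻¹ := SchrNn.inv hT0 hTn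
  have hTv : T * T⁻¹ = 1 := PowerSeries.mul_inv_cancel T (by rw [hT0]; norm_num)
  set f : PowerSeries ℝ := 1 - (1 - X) * T⁻¹ ^ (w + 2) with hf
  have hf0 : constantCoeff f = 0 := by simp [hf, hT0]
  have hfs : HasSubst f := HasSubst.of_constantCoeff_zero' hf0
  have hfd := schr_deriv_f w m c T hT0 hTode
  rw [← hf] at hfd
  have hfX : X ^ (m + 1) ∣ f := by
    rw [X_pow_dvd_iff]
    intro i hi
    cases i with
    | zero => simpa using hf0
    | succ i =>
      have := congrArg (coeff i) hfd
      rw [coeff_derivative, mul_right_comm, coeff_mul_X_pow', if_neg (by omega)] at this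
      have h2 : ((i:ℝ) + 1) ≠ 0 := by positivity
      exact (mul_eq_zero.1 this).resolve_right h2
  have hCn : ∀ a : ℝ, 0 ≤ a → SchrNn (C a) := by
    intro a ha i
    rw [coeff_C]; split_ifs
    · exact ha
    · exact le_rfl
  have hXn : SchrNn (X : PowerSeries ℝ) := by
    intro i
    rw [coeff_X]; split_ifs <;> norm_num
  have hgn : SchrNn (T * f) := by
    have hg : T * f = T - (1 - X) * T⁻¹ ^ (w + 1) := by
      rw [hf]
      linear_combination (-(1 - X) * T⁻¹ ^ (w + 1)) * hTv
    have hgX : X ^ (m + 1) ∣ T * f := hfX.mul_left T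
    rw [X_pow_dvd_iff] at hgX
    intro i
    by_cases hi : i < m + 1
    · rw [hgX i hi]
    · cases i with
      | zero => omega
      | succ i =>
        have h1 := schr_deriv_g w m c T hT0 hTode
        rw [← hg] at h1
        have h2 := congrArg (coeff i) h1
        rw [map_add, coeff_derivative, coeff_derivative, hTc, if_neg (by omega), zero_mul,
          zero_add] at h2
        have h3 : SchrNn (C (1 / ((w : ℝ) + 2)) * T⁻¹ ^ (w + 1)
            + C (((w : ℝ) + 1) * c) * X ^ m * T⁻¹ ^ (w + 2)) :=
          ((hCn _ (by positivity)).mul (hvn.pow _)).add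
            (((hCn _ (by positivity)).mul (hXn.pow _)).mul (hvn.pow _))
        have h4 := h3 i
        rw [← h2] at h4
        have h5 : (0:ℝ) < (i:ℝ) + 1 := by positivity
        exact nonneg_of_mul_nonneg_left h4 h5
  have hfn : SchrNn f := by
    have : f = T⁻¹ * (T * f) := by linear_combination (-f) * hTv
    rw [this]
    exact hvn.mul hgn
  -- the substitution homomorphism
  obtain ⟨S, hS⟩ : ∃ S : PowerSeries ℝ →ₐ[ℝ] PowerSeries ℝ, ∀ φ, S φ = PowerSeries.subst f φ :=
    ⟨substAlgHom hfs, fun φ => by rw [← coe_substAlgHom hfs]⟩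
  have hSX : S X = f := by rw [hS, subst_X hfs]
  have hSn : ∀ φ, SchrNn φ → SchrNn (S φ) := by
    intro φ h
    rw [hS]; exact SchrNn.subst hfs hfn h
  have hS0 : ∀ φ, constantCoeff φ = 1 → constantCoeff (S φ) = 1 := by
    intro φ h
    obtain ⟨ψ, hψ⟩ : X ∣ φ - 1 := by rw [X_dvd_iff]; simp [h]
    have : φ = 1 + X * ψ := by rw [← hψ]; ring
    rw [this, map_add, map_mul, map_one, hSX]
    simp [hf0]
  have hTSn : ∀ φ, X ∣ φ → SchrNn φ → SchrNn (T * S φ) := by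
    rintro _ ⟨ψ, rfl⟩ h
    rw [map_mul, hSX, ← mul_assoc]
    refine hgn.mul (hSn _ fun i => ?_)
    have := h (i + 1)
    rwa [coeff_succ_X_mul] at this
  -- the fixed point identity
  have hβp : ∀ u : PowerSeries ℝ, constantCoeff u = 1 → 1 - (1 - X) * u⁻¹ ^ (w + 2) = 0 →
      u ^ (w + 2) = 1 - X := by
    intro u hu h
    have h1 : u * u⁻¹ = 1 := PowerSeries.mul_inv_cancel u (by rw [hu]; norm_num)
    have h2 : u ^ (w + 2) * u⁻¹ ^ (w + 2) = 1 := by rw [← mul_pow, h1, one_pow]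
    linear_combination (u ^ (w + 2)) * h + (1 - X) * h2
  have hβroot : β ^ (w + 2) = 1 - X := by
    apply hβp β hβ0
    have h1 := schr_deriv_f w m 0 β hβ0 hβode
    apply derivative.ext
    · rw [h1]; simp
    · simp [hβ0]
  have hTf : T ^ (w + 2) * (1 - f) = 1 - X := by
    have h2 : T ^ (w + 2) * T⁻¹ ^ (w + 2) = 1 := by rw [← mul_pow, hTv, one_pow]
    rw [hf]
    linear_combination (1 - X) * h2
  have hβT : β = T * S β := by
    apply schr_root_unique (w + 1) _ _ hβ0 (by rw [map_mul, hT0, hS0 β hβ0, one_mul])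
    rw [mul_pow, ← map_pow, hβroot, map_sub, map_one, hSX, hTf]
  obtain ⟨x, hx0, hxs⟩ : ∃ x : ℕ → PowerSeries ℝ, x 0 = 1 ∧ ∀ k, x (k + 1) = T * S (x k) :=
    ⟨fun k => Nat.rec 1 (fun _ y => T * S y) k, rfl, fun k => rfl⟩
  have hxc : ∀ k, constantCoeff (x k) = 1 := by
    intro k
    induction k with
    | zero => simp [hx0]
    | succ k ih => rw [hxs, map_mul, hT0, hS0 _ ih, one_mul]
  refine ⟨x, hx0, ?_, ?_⟩
  · intro k
    induction k with
    | zero =>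
      rw [hxs, hx0, map_one, mul_one, one_mul, hT]
      simp
    | succ k ih =>
      have hinv : (x (k + 1))⁻¹ = T⁻¹ * S (x k)⁻¹ := by
        symm
        rw [PowerSeries.eq_inv_iff_mul_eq_one (by rw [hxc]; norm_num), hxs]
        have h1 : S (x k)⁻¹ * S (x k) = 1 := by
          rw [← map_mul, PowerSeries.inv_mul_cancel _ (by rw [hxc]; norm_num), map_one]
        linear_combination h1 + (S (x k)⁻¹ * S (x k)) * hTv
      have hr : 1 - (1 - X) * (x (k + 1))⁻¹ ^ (w + 2) =
          S (1 - (1 - X) * (x k)⁻¹ ^ (w + 2)) := by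
        rw [hinv, map_sub, map_mul, map_sub, map_one, hSX, map_pow, mul_pow, hf]
        ring
      rw [hr, hxs (k + 1)]
      conv_lhs => rw [ih]
      rw [hxs k, map_mul, map_sum, mul_assoc]
      simp only [map_smul, map_pow]
  · have hsub : ∀ k, x (k + 1) - β = T * S (x k - β) := by
      intro k
      rw [map_sub, mul_sub, ← hβT, hxs]
    have hdv : ∀ k, X ^ ((m + 1) ^ k) ∣ x k - β := by
      intro k
      induction k with
      | zero => rw [pow_zero, pow_one, X_dvd_iff, hx0]; simp [hβ0]
      | succ k ih =>
        obtain ⟨ψ, hψ⟩ := ih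
        rw [hsub, hψ, map_mul, map_pow, hSX, pow_succ', pow_mul]
        exact ((pow_dvd_pow_of_dvd hfX _).mul_right _).mul_left _
    intro k
    refine ⟨hdv k, ?_, ?_, hxc k⟩
    · induction k with
      | zero =>
        intro i
        cases i with
        | zero => simp [hx0, hβ0]
        | succ i =>
          rw [hx0, map_sub, coeff_one, if_neg (by omega), hβ, coeff_mk]
          linarith [hbn i]
      | succ k ih =>
        rw [hsub]
        refine hTSn _ ?_ ih
        rw [X_dvd_iff]; simp [hxc, hβ0]
    · induction k with
      | zero => intro i; simp [hx0]
      | succ k ih =>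
        have h1 : 1 - x (k + 1) = (1 - T) + T * S (1 - x k) := by
          rw [hxs, map_sub, map_one]; ring
        rw [h1]
        refine SchrNn.add ?_ (hTSn _ ?_ ih)
        · intro i
          cases i with
          | zero => simp [hT0]
          | succ i =>
            rw [map_sub, coeff_one, if_neg (by omega)]
            linarith [hTn i]
        · rw [X_dvd_iff]; simp [hxc]

end

section
open PowerSeries

variable {R : Type} [NormedRing R] [NormedAlgebra ℂ R]

/-- The series `φ` converges absolutely at `B`, with sum `M`. -/
def SchrEv (B : R) (φ : PowerSeries ℝ) (M : R) : Prop :=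
  Summable (fun i => ‖((coeff i φ : ℝ) : ℂ) • B ^ i‖) ∧
    HasSum (fun i => ((coeff i φ : ℝ) : ℂ) • B ^ i) M

namespace SchrEv

theorem add {B : R} {φ ψ : PowerSeries ℝ} {M L : R} (h1 : SchrEv B φ M) (h2 : SchrEv B ψ L) :
    SchrEv B (φ + ψ) (M + L) := by
  have he : (fun i => ((coeff i (φ + ψ) : ℝ) : ℂ) • B ^ i) =
      fun i => ((coeff i φ : ℝ) : ℂ) • B ^ i + ((coeff i ψ : ℝ) : ℂ) • B ^ i := by
    funext i
    rw [map_add, Complex.ofReal_add, add_smul]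
  refine ⟨?_, ?_⟩
  · have := fun i => congrFun he i
    simp only [this]
    exact Summable.of_nonneg_of_le (fun _ => norm_nonneg _) (fun _ => norm_add_le _ _)
      (h1.1.add h2.1)
  · rw [he]
    exact h1.2.add h2.2

theorem smul {B : R} {φ : PowerSeries ℝ} {M : R} (c : ℝ) (h1 : SchrEv B φ M) :
    SchrEv B (c • φ) ((c : ℂ) • M) := by
  have he : ∀ i, ((coeff i (c • φ) : ℝ) : ℂ) • B ^ i = (c : ℂ) • ((coeff i φ : ℝ) : ℂ) • B ^ i := by
    intro i
    rw [coeff_smul, smul_eq_mul, Complex.ofReal_mul, mul_smul]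
  refine ⟨?_, ?_⟩
  · simp only [he, norm_smul (c : ℂ)]
    exact h1.1.mul_left _
  · simp only [he]
    exact h1.2.const_smul _

theorem sub {B : R} {φ ψ : PowerSeries ℝ} {M L : R} (h1 : SchrEv B φ M) (h2 : SchrEv B ψ L) :
    SchrEv B (φ - ψ) (M - L) := by
  have := h1.add (h2.smul (-1))
  simpa [sub_eq_add_neg] using this

theorem monomial (B : R) (n : ℕ) : SchrEv B (X ^ n) (B ^ n) := by
  have hz : ∀ i, i ≠ n → ((coeff i (X ^ n : PowerSeries ℝ) : ℝ) : ℂ) • B ^ i = 0 := by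
    intro i hi
    simp [coeff_X_pow, hi]
  refine ⟨?_, ?_⟩
  · apply summable_of_ne_finset_zero (s := {n})
    intro i hi
    rw [hz i (by simpa using hi), norm_zero]
  · have := hasSum_single (f := fun i => ((coeff i (X ^ n : PowerSeries ℝ) : ℝ) : ℂ) • B ^ i) n hz
    simpa [coeff_X_pow] using this

theorem one (B : R) : SchrEv B 1 1 := by
  simpa using monomial B 0

theorem mul [CompleteSpace R] {B : R} {φ ψ : PowerSeries ℝ} {M L : R}
    (h1 : SchrEv B φ M) (h2 : SchrEv B ψ L) : SchrEv B (φ * ψ) (M * L) := by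
  have he : ∀ i, ((coeff i (φ * ψ) : ℝ) : ℂ) • B ^ i =
      ∑ x ∈ Finset.HasAntidiagonal.antidiagonal i, (((coeff x.1 φ : ℝ) : ℂ) • B ^ x.1) *
        (((coeff x.2 ψ : ℝ) : ℂ) • B ^ x.2) := by
    intro i
    rw [coeff_mul, Complex.ofReal_sum, Finset.sum_smul]
    refine Finset.sum_congr rfl fun x hx => ?_
    rw [smul_mul_smul_comm, ← pow_add, Finset.HasAntidiagonal.mem_antidiagonal.1 hx,
      Complex.ofReal_mul]
  have hs := summable_norm_sum_mul_antidiagonal_of_summable_norm h1.1 h2.1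
  have ht := tsum_mul_tsum_eq_tsum_sum_antidiagonal_of_summable_norm h1.1 h2.1
  refine ⟨?_, ?_⟩
  · simpa only [he] using hs
  · simp only [he]
    rw [h1.2.tsum_eq, h2.2.tsum_eq] at ht
    rw [ht]
    exact hs.of_norm.hasSum

theorem pow [CompleteSpace R] {B : R} {φ : PowerSeries ℝ} {M : R}
    (h1 : SchrEv B φ M) (n : ℕ) : SchrEv B (φ ^ n) (M ^ n) := by
  induction n with
  | zero => simpa using one B
  | succ n ih => rw [pow_succ, pow_succ]; exact ih.mul h1

theorem zero (B : R) : SchrEv B 0 0 := by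
  simpa using (one B).smul 0

theorem sum {B : R} (s : Finset ℕ) (φ : ℕ → PowerSeries ℝ) (M : ℕ → R)
    (h : ∀ i, SchrEv B (φ i) (M i)) : SchrEv B (∑ i ∈ s, φ i) (∑ i ∈ s, M i) := by
  classical
  induction s using Finset.induction_on with
  | empty => simpa using zero B
  | insert a s ha ih => rw [Finset.sum_insert ha, Finset.sum_insert ha]; exact (h a).add ih

theorem of_bounded [CompleteSpace R] {B : R} (hB : ‖B‖ < 1) {φ : PowerSeries ℝ}
    (h : ∀ i, |coeff i φ| ≤ 1) : ∃ M, SchrEv B φ M := by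
  have hs : Summable (fun i => ‖((coeff i φ : ℝ) : ℂ) • B ^ i‖) := by
    rw [← summable_nat_add_iff 1]
    refine Summable.of_nonneg_of_le (fun _ => norm_nonneg _) (fun i => ?_)
      ((summable_nat_add_iff 1).2 (summable_geometric_of_lt_one (norm_nonneg B) hB))
    rw [norm_smul, Complex.norm_real, Real.norm_eq_abs]
    calc _ ≤ 1 * ‖B‖ ^ (i + 1) :=
          mul_le_mul (h _) (norm_pow_le' B (Nat.succ_pos i)) (norm_nonneg _) zero_le_one
      _ = _ := one_mul _
  exact ⟨_, hs, hs.of_norm.hasSum⟩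

theorem unique {B : R} {φ : PowerSeries ℝ} {M L : R} (h1 : SchrEv B φ M) (h2 : SchrEv B φ L) :
    M = L := h1.2.unique h2.2

end SchrEv

theorem schr_banach [CompleteSpace R] (w m : ℕ) (b : ℕ → ℝ) (hb0 : b 0 = 1)
    (hbn : ∀ i, b (i + 1) ≤ 0)
    (hrec : ∀ i : ℕ, ((i : ℝ) + 1) * b (i + 1) = ((i : ℝ) - 1 / ((w : ℝ) + 2)) * b i)
    (hs : ∀ n, 0 ≤ ∑ i ∈ Finset.range n, b i)
    (B : R) (hB : ‖B‖ < 1) (Z : ℕ → R) (hZ0 : Z 0 = 1)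
    (hZ : ∀ k, Z (k + 1) = Z k * ∑ i ∈ Finset.range (m + 1),
      ((b i : ℂ) • (1 - (1 - B) * Ring.inverse (Z k ^ (w + 2))) ^ i)) :
    ∃ S : R, HasSum (fun i => (b i : ℂ) • B ^ i) S ∧
      ∀ k, ‖Z k - S‖ ≤ (∑ i ∈ Finset.range ((m + 1) ^ k), b i) * ‖B‖ ^ ((m + 1) ^ k) := by
  obtain ⟨x, hx0, hxs, hx⟩ := schr_series_main w m b hb0 hbn hrec
  have hsum : ∀ n, ∑ i ∈ Finset.range n, -b (i + 1) ≤ 1 := by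
    intro n
    have := hs (n + 1)
    rw [Finset.sum_range_succ', hb0] at this
    rw [Finset.sum_neg_distrib]
    linarith
  have hb1 : ∀ i, |b i| ≤ 1 := by
    intro i
    cases i with
    | zero => simp [hb0]
    | succ i =>
      rw [abs_of_nonpos (hbn i)]
      exact le_trans (Finset.single_le_sum (f := fun j => -b (j + 1))
        (fun j _ => by linarith [hbn j]) (Finset.self_mem_range_succ i)) (hsum (i + 1))
  obtain ⟨S, hS⟩ := SchrEv.of_bounded (φ := mk b) hB (by simpa using hb1)
  have hxn : ∀ k i, coeff (i + 1) (x k) ≤ 0 := by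
    intro k i
    have := (hx k).2.2.1 (i + 1)
    rw [map_sub, coeff_one, if_neg (by omega)] at this
    linarith
  have hxb : ∀ k i, b i ≤ coeff i (x k) := by
    intro k i
    have := (hx k).2.1 i
    rw [map_sub, coeff_mk] at this
    linarith
  have hev : ∀ k, SchrEv B (x k) (Z k) := by
    intro k
    induction k with
    | zero => rw [hx0, hZ0]; exact SchrEv.one B
    | succ k ih =>
      have hc := (hx k).2.2.2
      obtain ⟨Y, hY⟩ := SchrEv.of_bounded (φ := (x k)⁻¹) hB (fun i => by
        rw [abs_of_nonneg (SchrNn.inv hc (hxn k) i)]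
        refine SchrNn.inv_le hc (hxn k) (fun n => le_trans ?_ (hsum n)) i
        exact Finset.sum_le_sum fun j _ => neg_le_neg (hxb k _))
      have h1 : Z k * Y = 1 := by
        have := ih.mul hY
        rw [PowerSeries.mul_inv_cancel _ (by rw [hc]; norm_num)] at this
        exact this.unique (SchrEv.one B)
      have h2 : Y * Z k = 1 := by
        have := hY.mul ih
        rw [PowerSeries.inv_mul_cancel _ (by rw [hc]; norm_num)] at this
        exact this.unique (SchrEv.one B)
      have hinv : Ring.inverse (Z k ^ (w + 2)) = Y ^ (w + 2) := by
        have := Ring.inverse_unit ((⟨Z k, Y, h1, h2⟩ : Rˣ) ^ (w + 2))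
        simpa [← inv_pow] using this
      rw [hxs, hZ, hinv]
      refine ih.mul (SchrEv.sum _ _ _ fun i => ((SchrEv.pow ?_ i).smul _))
      refine (SchrEv.one B).sub (((SchrEv.one B).sub ?_).mul (hY.pow _))
      simpa using SchrEv.monomial B 1
  refine ⟨S, by simpa using hS.2, fun k => ?_⟩
  have hE := ((hev k).sub hS).2.tendsto_sum_nat
  set M := (m + 1) ^ k with hM
  have hMpos : 0 < M := by positivity
  refine le_of_tendsto hE.norm ?_
  filter_upwards [Filter.eventually_ge_atTop M] with n hn
  have hz : ∀ i < M, coeff i (x k - mk b) = 0 := X_pow_dvd_iff.1 (hx k).1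
  rw [← Finset.sum_range_add_sum_Ico _ hn, Finset.sum_eq_zero (fun i hi => by
    rw [hz i (Finset.mem_range.1 hi)]; simp), zero_add]
  have hsn := hs n
  rw [← Finset.sum_range_add_sum_Ico _ hn] at hsn
  calc _ ≤ ∑ i ∈ Finset.Ico M n, (-b i) * ‖B‖ ^ M := by
        refine norm_sum_le_of_le _ fun i hi => ?_
        obtain ⟨hi1, hi2⟩ := Finset.mem_Ico.1 hi
        have hpos := (hx k).2.1 i
        rw [norm_smul, Complex.norm_real, Real.norm_eq_abs, abs_of_nonneg hpos]
        have h1 : coeff i (x k - mk b) ≤ -b i := by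
          rw [map_sub, coeff_mk]
          obtain ⟨j, rfl⟩ : ∃ j, i = j + 1 := ⟨i - 1, by omega⟩
          linarith [hxn k j]
        refine mul_le_mul h1 ?_ (norm_nonneg _) (hpos.trans h1)
        exact (norm_pow_le' B (by omega)).trans
          (pow_le_pow_of_le_one (norm_nonneg _) hB.le hi1)
    _ = (∑ i ∈ Finset.Ico M n, (-b i)) * ‖B‖ ^ M := by rw [Finset.sum_mul]
    _ ≤ _ := by
        refine mul_le_mul_of_nonneg_right ?_ (by positivity)
        rw [Finset.sum_neg_distrib]
        linarith

end

/-- A synonym of the matrix algebra, to carry the norm `N`. -/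
def SchrMat (n : ℕ) : Type := Matrix (Fin n) (Fin n) ℂ

noncomputable instance (n : ℕ) : Ring (SchrMat n) :=
  inferInstanceAs (Ring (Matrix (Fin n) (Fin n) ℂ))

noncomputable instance (n : ℕ) : Algebra ℂ (SchrMat n) :=
  inferInstanceAs (Algebra ℂ (Matrix (Fin n) (Fin n) ℂ))

instance (n : ℕ) : FiniteDimensional ℂ (SchrMat n) :=
  inferInstanceAs (FiniteDimensional ℂ (Matrix (Fin n) (Fin n) ℂ))


/-- Error estimate for the matrix Schröder iteration: if N is a submultiplicative matrix
norm with N(B) < 1, then the binomial family (b_i·B^i) is summable, and with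
A^{1/p} = Σ b_i·B^i and s_j = Σ_{i<j} b_i one has
N(X_k − A^{1/p}) ≤ s_{(m+1)^k}·N(B)^{(m+1)^k} ≤ N(B)^{(m+1)^k}. -/
theorem matrix_schroder_error_estimate
    (p m : ℕ) (hp : 2 ≤ p) (hm : 1 ≤ m)
    (b : ℕ → ℝ)
    (hb : ∀ i, b i = (∏ j ∈ Finset.range i, ((j : ℝ) - 1 / p)) / (Nat.factorial i : ℝ))
    (n : ℕ) (hn : 1 ≤ n)
    (B : Matrix (Fin n) (Fin n) ℂ)
    (hρ : spectralRadius ℂ B < 1)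
    (A : Matrix (Fin n) (Fin n) ℂ) (hA : A = 1 - B)
    (X : ℕ → Matrix (Fin n) (Fin n) ℂ)
    (hX0 : X 0 = 1)
    (hX : ∀ k, X (k + 1) = X k * ∑ i ∈ Finset.range (m + 1),
      ((b i : ℂ) • (1 - A * (X k ^ p)⁻¹) ^ i))
    (N : Matrix (Fin n) (Fin n) ℂ → ℝ)
    (hN0 : ∀ M, 0 ≤ N M)
    (hNeq0 : ∀ M, N M = 0 ↔ M = 0)
    (hNsmul : ∀ (c : ℂ) (M : Matrix (Fin n) (Fin n) ℂ), N (c • M) = ‖c‖ * N M)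
    (hNadd : ∀ M₁ M₂, N (M₁ + M₂) ≤ N M₁ + N M₂)
    (hNmul : ∀ M₁ M₂, N (M₁ * M₂) ≤ N M₁ * N M₂)
    (hNB : N B < 1) :
    Summable (fun i => (b i : ℂ) • B ^ i) ∧
    ∀ k, N (X k - ∑' i, (b i : ℂ) • B ^ i) ≤
          (∑ i ∈ Finset.range ((m + 1) ^ k), b i) * N B ^ ((m + 1) ^ k) ∧
        (∑ i ∈ Finset.range ((m + 1) ^ k), b i) * N B ^ ((m + 1) ^ k) ≤
          N B ^ ((m + 1) ^ k) := by
  obtain ⟨w, rfl⟩ : ∃ w, p = w + 2 := ⟨p - 2, by omega⟩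
  have hb0 : b 0 = 1 := by rw [hb]; simp
  have hrec : ∀ i : ℕ, ((i : ℝ) + 1) * b (i + 1) = ((i : ℝ) - 1 / ((w : ℝ) + 2)) * b i := by
    intro i
    rw [hb, hb, Finset.prod_range_succ, Nat.factorial_succ]
    have : (Nat.factorial i : ℝ) ≠ 0 := by positivity
    push_cast
    set Q := ∏ j ∈ Finset.range i, ((j : ℝ) - 1 / ((w : ℝ) + 2))
    set a := (i : ℝ) - 1 / ((w : ℝ) + 2)
    field_simp
  have hw : (1:ℝ) / ((w : ℝ) + 2) ≤ 1 := by
    rw [div_le_one (by positivity)]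
    have : (0:ℝ) ≤ w := Nat.cast_nonneg w
    linarith
  have hw0 : (0:ℝ) < 1 / ((w : ℝ) + 2) := by positivity
  have hbn : ∀ i, b (i + 1) ≤ 0 := by
    intro i
    induction i with
    | zero =>
      have := hrec 0
      simp only [Nat.cast_zero, zero_add, one_mul, hb0, mul_one, zero_sub] at this
      rw [zero_add, this]; linarith
    | succ i ih =>
      have h1 := hrec (i + 1)
      push_cast at h1
      have hi : (0:ℝ) ≤ i := Nat.cast_nonneg i
      have h2 : ((i:ℝ) + 1 - 1 / ((w : ℝ) + 2)) * b (i + 1) ≤ 0 :=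
        mul_nonpos_of_nonneg_of_nonpos (by linarith) ih
      rw [← h1] at h2
      by_contra hcon
      push Not at hcon
      have : 0 < ((i:ℝ) + 1 + 1) * b (i + 1 + 1) := mul_pos (by linarith) hcon
      linarith
  have hs' : ∀ n : ℕ, (1 / ((w : ℝ) + 2)) * ∑ i ∈ Finset.range (n + 1), b i
      = -((n : ℝ) + 1) * b (n + 1) := by
    intro n
    induction n with
    | zero =>
      have := hrec 0
      simp at this ⊢
      rw [this, hb0]; ring
    | succ n ih =>
      rw [Finset.sum_range_succ, mul_add, ih]
      have := hrec (n + 1)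
      push_cast at this ⊢
      linarith
  have hs : ∀ n, 0 ≤ ∑ i ∈ Finset.range n, b i := by
    intro n
    cases n with
    | zero => simp
    | succ n =>
      have h1 := hs' n
      have h2 : 0 ≤ -((n : ℝ) + 1) * b (n + 1) := by
        have := hbn n
        have : (0:ℝ) ≤ n := Nat.cast_nonneg n
        nlinarith
      rw [← h1] at h2
      exact nonneg_of_mul_nonneg_right h2 hw0
  have hs1 : ∀ n, ∑ i ∈ Finset.range n, b i ≤ 1 := by
    intro n
    cases n with
    | zero => simp
    | succ n =>
      rw [Finset.sum_range_succ', hb0]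
      have := Finset.sum_nonpos (s := Finset.range n) (f := fun i => b (i + 1)) fun i _ => hbn i
      linarith
  let nn : Norm (SchrMat n) := ⟨N⟩
  have core : NormedSpace.Core ℂ (SchrMat n) :=
    { norm_nonneg := hN0
      norm_smul := hNsmul
      norm_triangle := hNadd
      norm_eq_zero_iff := hNeq0 }
  let nr : NormedRing (SchrMat n) :=
    { (inferInstance : Ring (SchrMat n)), nn,
      (NormedAddCommGroup.ofCore core).toMetricSpace with
      dist_eq := (NormedAddCommGroup.ofCore core).dist_eq
      norm_mul_le := hNmul }
  let na : NormedAlgebra ℂ (SchrMat n) :=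
    { (inferInstance : Algebra ℂ (SchrMat n)) with
      norm_smul_le := fun c M => (hNsmul c M).le }
  have hcomp : CompleteSpace (SchrMat n) := FiniteDimensional.complete ℂ (SchrMat n)
  obtain ⟨S, hS, hest⟩ := schr_banach (R := SchrMat n) w m b hb0 hbn hrec hs B hNB X hX0 (by
    intro k
    have h := hX k
    rw [hA, Matrix.nonsing_inv_eq_ringInverse] at h
    exact h)
  let e : SchrMat n →ₗ[ℂ] Matrix (Fin n) (Fin n) ℂ := 
    { toFun := fun x => x, map_add' := fun _ _ => rfl, map_smul' := fun _ _ => rfl }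
  have he : Continuous e := LinearMap.continuous_of_finiteDimensional e
  have hS2 : HasSum (fun i => (b i : ℂ) • B ^ i) (e S) := hS.map e he
  refine ⟨hS2.summable, fun k => ⟨?_, ?_⟩⟩
  · rw [hS2.tsum_eq]
    exact hest k
  · exact mul_le_of_le_one_left (pow_nonneg (hN0 B) _) (hs1 _)
end

section
/- For every k ≥ 0 the matrix X_k is invertible, the sequence (X_k) is entrywise monotonically decreasing (X_{k+1} ≤ X_k entrywise), satisfies X_k ≥ A^{1/p} entrywise where A^{1/p} := Σ_{i=0}^∞ b_i·B^i (this family is summable), and X_k converges to A^{1/p} as k → ∞. -/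
namespace SchroderAux
open PowerSeries


/-- coefficientwise nonnegativity -/
def PNN (F : ℝ⟦X⟧) : Prop := ∀ i, 0 ≤ coeff i F

lemma PNN.add {F G : ℝ⟦X⟧} (hF : PNN F) (hG : PNN G) : PNN (F + G) := fun i => by
  rw [map_add]; exact add_nonneg (hF i) (hG i)

lemma PNN.mul {F G : ℝ⟦X⟧} (hF : PNN F) (hG : PNN G) : PNN (F * G) := fun i => by
  rw [coeff_mul]; exact Finset.sum_nonneg fun x _ => mul_nonneg (hF _) (hG _)

lemma PNN.smul {F : ℝ⟦X⟧} {c : ℝ} (hc : 0 ≤ c) (hF : PNN F) : PNN (c • F) := fun i => by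
  rw [coeff_smul]; exact mul_nonneg hc (hF i)

lemma PNN.one : PNN 1 := fun i => by
  rw [coeff_one]; split_ifs <;> norm_num

lemma PNN.X : PNN X := fun i => by
  rw [coeff_X]; split_ifs <;> norm_num

lemma PNN.pow {F : ℝ⟦X⟧} (hF : PNN F) (k : ℕ) : PNN (F ^ k) := by
  induction k with
  | zero => rw [pow_zero]; exact PNN.one
  | succ k ih => rw [pow_succ]; exact ih.mul hF

lemma PNN.sum {ι : Type*} {s : Finset ι} {F : ι → ℝ⟦X⟧} (hF : ∀ i ∈ s, PNN (F i)) :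
    PNN (∑ i ∈ s, F i) := fun i => by
  rw [map_sum]; exact Finset.sum_nonneg fun x hx => hF x hx i

lemma PNN.subst {F R : ℝ⟦X⟧} (hF : PNN F) (hR : PNN R) (h0 : constantCoeff R = 0) :
    PNN (F.subst R) := fun i => by
  rw [PowerSeries.coeff_subst' (HasSubst.of_constantCoeff_zero' h0)]
  exact finsum_nonneg fun d => mul_nonneg (hF d) (hR.pow d i)

/-- inverse recursion -/
lemma inv_rec {F : ℝ⟦X⟧} (h1 : coeff 0 F = 1) (N : ℕ) :
    coeff (N + 1) F⁻¹ = ∑ i ∈ Finset.range (N + 1), (- coeff (i + 1) F) * coeff (N - i) F⁻¹ := by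
  have h : F * F⁻¹ = 1 := PowerSeries.mul_inv_cancel F (by
    rw [← coeff_zero_eq_constantCoeff_apply, h1]; norm_num)
  have h2 := congrArg (coeff (N + 1)) h
  rw [coeff_mul, Finset.Nat.sum_antidiagonal_eq_sum_range_succ_mk, Finset.sum_range_succ'] at h2
  simp only [coeff_one, h1] at h2
  simp only [Nat.add_sub_add_right, Nat.sub_zero, one_mul] at h2
  simp only [neg_mul, Finset.sum_neg_distrib]
  have : ¬ (N + 1 = 0) := by omega
  simp only [this, if_false] at h2
  linarith

lemma psinv_coeff_zero {F : ℝ⟦X⟧} (h1 : coeff 0 F = 1) : coeff 0 F⁻¹ = 1 := by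
  rw [coeff_zero_eq_constantCoeff_apply] at *
  rw [constantCoeff_inv, h1, inv_one]

lemma PNN.inv {F : ℝ⟦X⟧} (h1 : coeff 0 F = 1) (h : ∀ i, coeff (i + 1) F ≤ 0) : PNN F⁻¹ := by
  intro i
  induction i using Nat.strong_induction_on with
  | _ i ih =>
    cases i with
    | zero => rw [psinv_coeff_zero h1]; norm_num
    | succ N =>
      rw [inv_rec h1]
      refine Finset.sum_nonneg fun i hi => mul_nonneg (by linarith [h i]) (ih _ ?_)
      omega

lemma inv_le_one {F : ℝ⟦X⟧} (h1 : coeff 0 F = 1) (h : ∀ i, coeff (i + 1) F ≤ 0)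
    (hs : ∀ N, 0 ≤ ∑ i ∈ Finset.range (N + 1), coeff i F) (i : ℕ) : coeff i F⁻¹ ≤ 1 := by
  induction i using Nat.strong_induction_on with
  | _ i ih =>
    cases i with
    | zero => rw [psinv_coeff_zero h1]
    | succ N =>
      rw [inv_rec h1]
      calc _ ≤ ∑ i ∈ Finset.range (N + 1), (- coeff (i + 1) F) := by
            refine Finset.sum_le_sum fun i hi => ?_
            have := ih (N - i) (by omega)
            nlinarith [h i]
        _ ≤ 1 := by
            have := hs (N + 1)
            rw [Finset.sum_range_succ', h1] at this
            rw [Finset.sum_neg_distrib]; linarith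

/-- derivative nonneg and constant term zero -/
lemma PNN.of_deriv {F : ℝ⟦X⟧} (h0 : 0 ≤ coeff 0 F) (h : PNN (d⁄dX ℝ F)) : PNN F := by
  intro i
  cases i with
  | zero => exact h0
  | succ i =>
    have := h i
    rw [coeff_derivative] at this
    exact nonneg_of_mul_nonneg_left this (by positivity)

/-- truncated binomial polynomial evaluated at a power series -/
noncomputable def TT (b : ℕ → ℝ) (m : ℕ) (R : ℝ⟦X⟧) : ℝ⟦X⟧ :=
  ∑ i ∈ Finset.range (m + 1), b i • R ^ i

lemma coeff_TT_X (b : ℕ → ℝ) (m i : ℕ) :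
    coeff i (TT b m X) = if i < m + 1 then b i else 0 := by
  simp [TT, coeff_X_pow, Finset.mem_range]

lemma subst_TT (b : ℕ → ℝ) (m : ℕ) {R : ℝ⟦X⟧} (h0 : constantCoeff R = 0) :
    (TT b m X).subst R = TT b m R := by
  have hs := HasSubst.of_constantCoeff_zero' h0
  rw [← coe_substAlgHom hs, TT, TT, map_sum]
  refine Finset.sum_congr rfl fun i _ => ?_
  rw [map_smul, map_pow, substAlgHom_X]

lemma const_TT (b : ℕ → ℝ) (hb0 : b 0 = 1) (m : ℕ) {R : ℝ⟦X⟧} (h0 : constantCoeff R = 0) :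
    constantCoeff (TT b m R) = 1 := by
  rw [TT, Finset.sum_range_succ', map_add, map_sum]
  simp [h0, hb0, constantCoeff_smul]

section
variable {b : ℕ → ℝ} {q m : ℕ} (hb0 : b 0 = 1)
  (hrec : ∀ i : ℕ, ((q : ℝ) + 1) * (i + 1) * b (i + 1) = (((q : ℝ) + 1) * i - 1) * b i)
  (hneg : ∀ i, b (i + 1) < 0) (hm : 1 ≤ m)

include hrec in
lemma TT_ode : TT b m X + C ((q : ℝ) + 1) * ((1 - X) * d⁄dX ℝ (TT b m X)) =
    C ((1 - ((q : ℝ) + 1) * m) * b m) * X ^ m := by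
  ext i
  rw [map_add, coeff_C_mul, coeff_C_mul, coeff_TT_X, sub_mul, one_mul, map_sub, coeff_X_pow,
    coeff_derivative, coeff_TT_X]
  cases i with
  | zero =>
    have h := hrec 0
    simp only [coeff_zero_X_mul]
    rcases Nat.eq_zero_or_pos m with rfl | h0
    · simp
    · have h1 : 0 < m + 1 := by omega
      have h3 : ¬ (0 = m) := by omega
      simp only [h0, h1, h3, if_true, if_false, Nat.add_lt_add_iff_right]
      push_cast at *
      linarith
  | succ i =>
    have h := hrec (i + 1)
    rw [coeff_succ_X_mul, coeff_derivative, coeff_TT_X]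
    rcases lt_trichotomy (i + 1) m with hl | hl | hl
    · have h1 : i + 1 + 1 < m + 1 := by omega
      have h2 : i + 1 < m + 1 := by omega
      have h3 : ¬ (i + 1 = m) := by omega
      simp only [h1, h2, h3, if_true, if_false]
      push_cast at *
      linarith
    · subst hl
      simp
      ring
    · have h1 : ¬ (i + 1 + 1 < m + 1) := by omega
      have h2 : ¬ (i + 1 < m + 1) := by omega
      have h3 : ¬ (i + 1 = m) := by omega
      simp [h1, h2, h3]

include hb0 in
lemma TT_mul_inv : TT b m X * (TT b m X)⁻¹ = 1 :=
  PowerSeries.mul_inv_cancel _ (by rw [const_TT b hb0 m (by simp)]; norm_num)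

include hb0 hneg in
lemma TT_inv_PNN : PNN (TT b m X)⁻¹ := by
  apply PNN.inv
  · rw [coeff_TT_X]; simp [hb0]
  · intro i; rw [coeff_TT_X]; split_ifs
    · exact (hneg i).le
    · exact le_rfl

lemma deriv_S (k : ℕ) (T : ℝ⟦X⟧) : d⁄dX ℝ ((1 - X) * T⁻¹ ^ k) =
    - T⁻¹ ^ k - (k : ℝ⟦X⟧) * T⁻¹ ^ (k + 1) * ((1 - X) * d⁄dX ℝ T) := by
  rw [Derivation.leibniz, map_sub, derivative_X, derivative_one, derivative_pow, derivative_inv']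
  simp only [smul_eq_mul]
  cases k with
  | zero => simp
  | succ k => simp only [Nat.add_sub_cancel]; ring

/-- residual function -/
noncomputable def ff (b : ℕ → ℝ) (q m : ℕ) : ℝ⟦X⟧ := 1 - (1 - X) * (TT b m X)⁻¹ ^ (q + 1)

include hb0 hrec in
lemma deriv_ff : d⁄dX ℝ (ff b q m) =
    C ((1 - ((q : ℝ) + 1) * m) * b m) * X ^ m * (TT b m X)⁻¹ ^ (q + 2) := by
  rw [← TT_ode hrec, ff, map_sub, deriv_S, derivative_one]
  have h := TT_mul_inv (m := m) hb0
  simp only [map_add, map_natCast, map_one]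
  push_cast
  linear_combination (-(TT b m X)⁻¹ ^ (q + 1)) * h

include hneg hm in
lemma c_nonneg : 0 ≤ (1 - ((q : ℝ) + 1) * m) * b m := by
  obtain ⟨k, rfl⟩ : ∃ k, m = k + 1 := ⟨m - 1, by omega⟩
  have := hneg k
  push_cast
  have h : (0:ℝ) ≤ q * (k + 1) + k := by positivity
  nlinarith

include hb0 in
lemma ff_zero : coeff 0 (ff b q m) = 0 := by
  rw [coeff_zero_eq_constantCoeff_apply, ff]
  simp [constantCoeff_inv, const_TT b hb0 m (R := X) (by simp)]

lemma PNN.C {c : ℝ} (hc : 0 ≤ c) : PNN (PowerSeries.C c) := fun i => by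
  rw [coeff_C]; split_ifs <;> simp [hc]

include hb0 hrec hneg hm in
lemma ff_PNN : PNN (ff b q m) := by
  apply PNN.of_deriv (ff_zero hb0).ge
  rw [deriv_ff hb0 hrec]
  exact ((PNN.C (c_nonneg hneg hm)).mul (PNN.X.pow m)).mul ((TT_inv_PNN hb0 hneg).pow _)

include hb0 hrec in
lemma ff_dvd : X ^ (m + 1) ∣ ff b q m := by
  rw [X_pow_dvd_iff]
  intro i hi
  cases i with
  | zero => exact ff_zero hb0
  | succ i =>
    have h : X ^ m ∣ d⁄dX ℝ (ff b q m) := by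
      rw [deriv_ff hb0 hrec]
      exact (Dvd.intro_left _ rfl).mul_right _
    have h2 := X_pow_dvd_iff.1 h i (by omega)
    rw [coeff_derivative] at h2
    have : (i : ℝ) + 1 ≠ 0 := by positivity
    simpa [this] using h2

include hb0 in
lemma T_mul_ff : TT b m X * ff b q m = TT b m X - (1 - X) * (TT b m X)⁻¹ ^ q := by
  rw [ff]
  have h := TT_mul_inv (m := m) hb0
  linear_combination (-(1 - X) * (TT b m X)⁻¹ ^ q) * h

include hb0 hrec hneg hm in
lemma S_nonpos (i : ℕ) : coeff (i + 1) ((1 - X) * (TT b m X)⁻¹ ^ q) ≤ 0 := by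
  set S := (1 - X) * (TT b m X)⁻¹ ^ q with hS
  have key : C ((q : ℝ) + 1) * (d⁄dX ℝ S) = - ((TT b m X)⁻¹ ^ q
      + (q : ℝ) • (C ((1 - ((q : ℝ) + 1) * m) * b m) * X ^ m * (TT b m X)⁻¹ ^ (q + 1))) := by
    rw [← TT_ode hrec, hS, deriv_S]
    have h := TT_mul_inv (m := m) hb0
    rw [smul_eq_C_mul]
    simp only [map_add, map_natCast, map_one]
    linear_combination ((q : ℝ⟦X⟧) * (TT b m X)⁻¹ ^ q) * h
  have hU := TT_inv_PNN (m := m) hb0 hneg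
  have hP : PNN ((TT b m X)⁻¹ ^ q
      + (q : ℝ) • (C ((1 - ((q : ℝ) + 1) * m) * b m) * X ^ m * (TT b m X)⁻¹ ^ (q + 1))) :=
    (hU.pow _).add (PNN.smul (Nat.cast_nonneg q)
      (((PNN.C (c_nonneg hneg hm)).mul (PNN.X.pow m)).mul (hU.pow _)))
  have h1 := hP i
  have h2 := congrArg (coeff i) key
  rw [coeff_C_mul, coeff_derivative, map_neg] at h2
  have h3 : (0:ℝ) < ((q : ℝ) + 1) * (i + 1) := by positivity
  by_contra hc
  push Not at hc
  have := mul_pos h3 hc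
  linarith

include hb0 hrec hneg hm in
lemma h_PNN : PNN (TT b m X * ff b q m) := by
  intro i
  rcases Nat.lt_or_ge i (m + 1) with h | h
  · exact (X_pow_dvd_iff.1 ((ff_dvd (q := q) hb0 hrec).mul_left (TT b m X)) i h).ge
  · rw [T_mul_ff hb0, map_sub, coeff_TT_X, if_neg (by omega)]
    obtain ⟨k, rfl⟩ : ∃ k, i = k + 1 := ⟨i - 1, by omega⟩
    have := S_nonpos hb0 hrec hneg hm k
    linarith

/-- formal Schröder iteration -/
noncomputable def xs (b : ℕ → ℝ) (q m : ℕ) : ℕ → ℝ⟦X⟧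
  | 0 => 1
  | k + 1 => xs b q m k * TT b m (1 - (1 - X) * (xs b q m k)⁻¹ ^ (q + 1))

/-- formal residual -/
noncomputable def rs (b : ℕ → ℝ) (q m k : ℕ) : ℝ⟦X⟧ := 1 - (1 - X) * (xs b q m k)⁻¹ ^ (q + 1)

lemma xs_succ (k : ℕ) : xs b q m (k + 1) = xs b q m k * TT b m (rs b q m k) := rfl

lemma rs_const {k : ℕ} (h : constantCoeff (xs b q m k) = 1) : constantCoeff (rs b q m k) = 0 := by
  simp [rs, constantCoeff_inv, h]

include hb0 in
lemma xs_const (k : ℕ) : constantCoeff (xs b q m k) = 1 := by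
  induction k with
  | zero => simp [xs]
  | succ k ih => rw [xs_succ, map_mul, ih, const_TT b hb0 m (rs_const ih), one_mul]

include hb0 in
lemma xs_mul_inv (k : ℕ) : xs b q m k * (xs b q m k)⁻¹ = 1 :=
  PowerSeries.mul_inv_cancel _ (by rw [xs_const hb0]; norm_num)

include hb0 in
lemma rs_succ (k : ℕ) : rs b q m (k + 1) = (ff b q m).subst (rs b q m k) := by
  have h0 := rs_const (xs_const (q := q) (m := m) hb0 k)
  have hs := HasSubst.of_constantCoeff_zero' h0
  have hT : TT b m (rs b q m k) * (TT b m (rs b q m k))⁻¹ = 1 :=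
    PowerSeries.mul_inv_cancel _ (by rw [const_TT b hb0 m h0]; norm_num)
  have hU : (substAlgHom hs : ℝ⟦X⟧ →ₐ[ℝ] ℝ⟦X⟧) (TT b m X)⁻¹ = (TT b m (rs b q m k))⁻¹ := by
    have h1 := congrArg (substAlgHom hs : ℝ⟦X⟧ →ₐ[ℝ] ℝ⟦X⟧) (TT_mul_inv (m := m) hb0)
    rw [map_mul, map_one, coe_substAlgHom, subst_TT b m h0] at h1
    rw [coe_substAlgHom]
    calc _ = (TT b m (rs b q m k) * (TT b m (rs b q m k))⁻¹) * subst (rs b q m k) (TT b m X)⁻¹ := by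
          rw [hT, one_mul]
      _ = (TT b m (rs b q m k))⁻¹ * (TT b m (rs b q m k) * subst (rs b q m k) (TT b m X)⁻¹) := by ring
      _ = _ := by rw [h1, mul_one]
  rw [← coe_substAlgHom hs, ff, map_sub, map_mul, map_sub, map_pow, hU, map_one, substAlgHom_X]
  have hx : (1 - X) * (xs b q m k)⁻¹ ^ (q + 1) = 1 - rs b q m k := by rw [rs]; ring
  rw [← hx, rs, xs_succ, PowerSeries.mul_inv_rev, mul_pow]
  ring

include hb0 hrec hneg hm in
lemma rs_PNN (k : ℕ) : PNN (rs b q m k) := by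
  induction k with
  | zero =>
    have : rs b q m 0 = X := by simp [rs, xs]
    rw [this]; exact PNN.X
  | succ k ih =>
    rw [rs_succ hb0]
    exact (ff_PNN hb0 hrec hneg hm).subst ih (rs_const (xs_const hb0 k))

include hb0 hrec hneg hm in
lemma xr_PNN (k : ℕ) : PNN (xs b q m k * rs b q m k) := by
  induction k with
  | zero =>
    have : rs b q m 0 = X := by simp [rs, xs]
    rw [this, xs, one_mul]; exact PNN.X
  | succ k ih =>
    have h0 := rs_const (xs_const (q := q) (m := m) hb0 k)
    have hs := HasSubst.of_constantCoeff_zero' h0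
    obtain ⟨g, hg⟩ : X ∣ TT b m X * ff b q m :=
      ((dvd_pow_self X (by omega : m + 1 ≠ 0)).trans (ff_dvd (q := q) hb0 hrec)).mul_left _
    have hgP : PNN g := fun i => by
      have := h_PNN hb0 hrec hneg hm (i + 1)
      rwa [hg, coeff_succ_X_mul] at this
    have h2 := congrArg (subst (rs b q m k)) hg
    rw [subst_mul hs, subst_mul hs, subst_TT b m h0, ← rs_succ hb0, subst_X hs] at h2
    rw [xs_succ, mul_assoc, h2, ← mul_assoc]
    exact ih.mul (hgP.subst (rs_PNN hb0 hrec hneg hm k) h0)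

include hb0 hrec hm in
lemma rs_dvd (k : ℕ) : X ^ (k + 1) ∣ rs b q m k := by
  induction k with
  | zero =>
    have : rs b q m 0 = X := by simp [rs, xs]
    rw [this]; simp
  | succ k ih =>
    have h0 := rs_const (xs_const (q := q) (m := m) hb0 k)
    have hs := HasSubst.of_constantCoeff_zero' h0
    obtain ⟨g, hg⟩ : X ^ 2 ∣ ff b q m :=
      (pow_dvd_pow X (by omega)).trans (ff_dvd (q := q) hb0 hrec)
    rw [rs_succ hb0, hg, subst_mul hs, subst_pow hs, subst_X hs]
    refine Dvd.dvd.mul_right ?_ _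
    refine (pow_dvd_pow X (by omega : k + 1 + 1 ≤ (k + 1) * 2)).trans ?_
    rw [pow_mul]; exact pow_dvd_pow_of_dvd ih 2

include hb0 hrec hneg hm in
lemma xs_anti (k i : ℕ) : coeff i (xs b q m (k + 1)) ≤ coeff i (xs b q m k) := by
  have h : PNN (xs b q m k - xs b q m (k + 1)) := by
    have : xs b q m k - xs b q m (k + 1) = ∑ j ∈ Finset.range m,
        (- b (j + 1)) • ((xs b q m k * rs b q m k) * rs b q m k ^ j) := by
      rw [xs_succ, TT, Finset.sum_range_succ', hb0, mul_add, Finset.mul_sum]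
      simp only [pow_zero, one_smul, mul_one, neg_smul, Finset.sum_neg_distrib]
      rw [sub_add_cancel_right]
      congr 1
      refine Finset.sum_congr rfl fun j _ => ?_
      rw [mul_smul_comm, pow_succ]; congr 1; ring
    rw [this]
    exact PNN.sum fun j _ => PNN.smul (by linarith [hneg j])
      ((xr_PNN hb0 hrec hneg hm k).mul ((rs_PNN hb0 hrec hneg hm k).pow j))
  have := h i
  rw [map_sub] at this
  linarith

include hb0 hrec in
lemma s_pow : (mk b) ^ (q + 1) = 1 - (X : ℝ⟦X⟧) := by
  have h1 : C ((q : ℝ) + 1) * ((1 - X) * d⁄dX ℝ (mk b)) = - mk b := by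
    ext i
    rw [coeff_C_mul, sub_mul, one_mul, map_sub, coeff_derivative, coeff_mk, map_neg, coeff_mk]
    cases i with
    | zero =>
      have h := hrec 0
      simp only [coeff_zero_X_mul]
      push_cast at *
      linarith
    | succ i =>
      have h := hrec (i + 1)
      rw [coeff_succ_X_mul, coeff_derivative, coeff_mk]
      push_cast at *
      linarith
  have h2 : (1 - X) * d⁄dX ℝ ((mk b) ^ (q + 1)) = - (mk b) ^ (q + 1) := by
    rw [derivative_pow]
    simp only [map_add, map_natCast, map_one] at h1
    push_cast
    linear_combination (mk b) ^ q * h1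
  set F := (mk b) ^ (q + 1) with hF
  have hF0 : coeff 0 F = 1 := by
    rw [hF, coeff_zero_eq_constantCoeff_apply, map_pow, ← coeff_zero_eq_constantCoeff_apply,
      coeff_mk, hb0, one_pow]
  have hF1 : coeff 1 F = -1 := by
    have := congrArg (coeff 0) h2
    rw [sub_mul, one_mul, map_sub, coeff_derivative, coeff_zero_X_mul, map_neg, hF0] at this
    simpa using this
  have hF2 : ∀ i, coeff (i + 2) F = 0 := by
    intro i
    induction i with
    | zero =>
      have := congrArg (coeff 1) h2
      rw [sub_mul, one_mul, map_sub, coeff_derivative, coeff_succ_X_mul, coeff_derivative, map_neg,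
        hF1] at this
      norm_num at this
      simpa using this
    | succ i ih =>
      have := congrArg (coeff (i + 2)) h2
      rw [sub_mul, one_mul, map_sub, coeff_derivative, coeff_succ_X_mul, coeff_derivative, map_neg,
        ih] at this
      simp only [add_assoc] at this ih ⊢
      norm_num [ih] at this
      rcases this with h | h
      · exact h
      · exfalso
        have : (0:ℝ) < (i : ℝ) + (2 + 1) := by positivity
        linarith
  ext i
  rw [map_sub, coeff_one, coeff_X]
  match i with
  | 0 => simp [hF0]
  | 1 => simp [hF1]
  | i + 2 => simp [hF2]

include hb0 hrec hm in
lemma xs_eq (k i : ℕ) (hi : i ≤ k) : coeff i (xs b q m k) = b i := by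
  have h1 : xs b q m k ^ (q + 1) - mk b ^ (q + 1) = xs b q m k ^ (q + 1) * rs b q m k := by
    have h2 : xs b q m k ^ (q + 1) * (xs b q m k)⁻¹ ^ (q + 1) = 1 := by
      rw [← mul_pow, xs_mul_inv hb0, one_pow]
    rw [s_pow hb0 hrec, rs]
    linear_combination (1 - X) * h2
  have h3 := (Commute.all (xs b q m k) (mk b)).mul_geom_sum₂ (q + 1)
  rw [h1] at h3
  have hu : IsUnit (∑ i ∈ Finset.range (q + 1), xs b q m k ^ i * mk b ^ (q + 1 - 1 - i)) := by
    rw [isUnit_iff_constantCoeff, map_sum]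
    have : constantCoeff (mk b) = 1 := by
      rw [← coeff_zero_eq_constantCoeff_apply, coeff_mk, hb0]
    simp only [map_mul, map_pow, xs_const hb0, this, one_pow, mul_one, Finset.sum_const,
      Finset.card_range, nsmul_eq_mul, isUnit_iff_ne_zero]
    positivity
  have h4 : X ^ (k + 1) ∣ xs b q m k - mk b := by
    rw [← hu.dvd_mul_right, h3]
    exact (rs_dvd hb0 hrec hm k).mul_left _
  have := X_pow_dvd_iff.1 h4 i (by omega)
  rw [map_sub, coeff_mk] at this
  linarith

include hb0 hrec hneg hm in
lemma xs_ge (k i : ℕ) : b i ≤ coeff i (xs b q m k) := by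
  rw [← xs_eq (q := q) (m := m) hb0 hrec hm (max k i) i (le_max_right _ _)]
  exact antitone_nat_of_succ_le (f := fun k => coeff i (xs b q m k))
    (fun k => xs_anti hb0 hrec hneg hm k i) (le_max_left k i)

include hb0 hrec hneg hm in
lemma xs_nonpos (k i : ℕ) : coeff (i + 1) (xs b q m k) ≤ 0 := by
  have := antitone_nat_of_succ_le (f := fun k => coeff (i + 1) (xs b q m k))
    (fun k => xs_anti hb0 hrec hneg hm k (i + 1)) (Nat.zero_le k)
  simpa [xs, coeff_one] using this

include hrec in
lemma b_sum (N : ℕ) : ∑ i ∈ Finset.range (N + 1), b i = -(((q : ℝ) + 1) * (N + 1) * b (N + 1)) := by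
  induction N with
  | zero => have := hrec 0; simp at *; linarith
  | succ N ih =>
    rw [Finset.sum_range_succ, ih]
    have := hrec (N + 1)
    push_cast at *
    linarith

include hb0 hrec hneg in
lemma b_abs_le (i : ℕ) : |b i| ≤ 1 := by
  cases i with
  | zero => simp [hb0]
  | succ i =>
    have h1 := hneg i
    have h2 := hneg (i + 1)
    have h3 := b_sum hrec (i + 1)
    rw [Finset.sum_range_succ', hb0, Finset.sum_range_succ] at h3
    have h4 : ∑ j ∈ Finset.range i, b (j + 1) ≤ 0 := Finset.sum_nonpos fun j _ => (hneg j).le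
    have h5 : 0 ≤ -(((q : ℝ) + 1) * (↑(i + 1) + 1) * b (i + 1 + 1)) := by
      have : (0:ℝ) ≤ ((q : ℝ) + 1) * (↑(i + 1) + 1) := by positivity
      nlinarith
    rw [abs_of_neg h1]
    linarith

include hb0 hrec hneg hm in
lemma xs_abs_le (k i : ℕ) : |coeff i (xs b q m k)| ≤ |b i| := by
  cases i with
  | zero => rw [coeff_zero_eq_constantCoeff_apply, xs_const hb0, hb0]
  | succ i =>
    have h1 := xs_nonpos hb0 hrec hneg hm k i
    have h2 := xs_ge hb0 hrec hneg hm k (i + 1)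
    rw [abs_of_nonpos h1, abs_of_neg (hneg i)]
    linarith

include hb0 hrec hneg hm in
lemma xs_inv_abs_le (k i : ℕ) : |coeff i (xs b q m k)⁻¹| ≤ 1 := by
  have h1 : coeff 0 (xs b q m k) = 1 := by rw [coeff_zero_eq_constantCoeff_apply, xs_const hb0]
  have h2 := xs_nonpos hb0 hrec hneg hm k
  rw [abs_of_nonneg (PNN.inv h1 h2 i)]
  refine inv_le_one h1 h2 (fun N => ?_) i
  refine le_trans ?_ (Finset.sum_le_sum fun i _ => xs_ge hb0 hrec hneg hm k i)
  rw [b_sum hrec]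
  have := hneg N
  have : (0:ℝ) ≤ ((q : ℝ) + 1) * (N + 1) := by positivity
  nlinarith
end

/-- power series absolutely convergent at radius `r` -/
def WW (r : ℝ) (hr : 0 ≤ r) : Subalgebra ℝ ℝ⟦X⟧ where
  carrier := {F | Summable fun i => ‖coeff i F * r ^ i‖}
  mul_mem' := by
    intro F G hF hG
    have h := summable_norm_sum_mul_antidiagonal_of_summable_norm hF hG
    refine h.congr fun i => ?_
    rw [coeff_mul, Finset.sum_mul]
    congr 1
    refine Finset.sum_congr rfl fun x hx => ?_
    rw [← Finset.HasAntidiagonal.mem_antidiagonal.1 hx, pow_add]; ring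
  add_mem' := by
    intro F G hF hG
    refine Summable.of_nonneg_of_le (fun i => norm_nonneg _) (fun i => ?_) (Summable.add hF hG)
    rw [map_add, add_mul]; exact norm_add_le _ _
  algebraMap_mem' := by
    intro c
    refine summable_of_ne_finset_zero (s := {0}) fun i hi => ?_
    have : i ≠ 0 := by simpa using hi
    simp [PowerSeries.algebraMap_apply, coeff_C, this]

lemma X_mem_WW (r : ℝ) (hr : 0 ≤ r) : (X : ℝ⟦X⟧) ∈ WW r hr := by
  refine summable_of_ne_finset_zero (s := {1}) fun i hi => ?_
  have : i ≠ 1 := by simpa using hi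
  simp [coeff_X, this]

lemma mem_WW_of_le (r : ℝ) (hr : 0 ≤ r) (hr1 : r < 1) {F : ℝ⟦X⟧} (h : ∀ i, |coeff i F| ≤ 1) :
    F ∈ WW r hr := by
  refine Summable.of_nonneg_of_le (fun i => norm_nonneg _) (fun i => ?_)
    (summable_geometric_of_lt_one hr hr1)
  rw [norm_mul, Real.norm_eq_abs, norm_pow, Real.norm_eq_abs, abs_of_nonneg hr]
  have := pow_nonneg hr i
  nlinarith [h i]

section
variable {𝔸 : Type*} [NormedRing 𝔸] [NormedAlgebra ℝ 𝔸] [CompleteSpace 𝔸] {B : 𝔸} {r : ℝ}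
  {hr : 0 ≤ r} (hB : ∀ᶠ i in Filter.atTop, ‖B ^ i‖ ≤ r ^ i)

include hB in
omit [CompleteSpace 𝔸] in
lemma ev_norm_summable {F : ℝ⟦X⟧} (hF : F ∈ WW r hr) : Summable fun i => ‖coeff i F • B ^ i‖ := by
  refine Summable.of_norm_bounded_eventually_nat hF ?_
  filter_upwards [hB] with i hi
  rw [norm_norm, norm_smul, norm_mul, norm_pow r, Real.norm_eq_abs r, abs_of_nonneg hr]
  gcongr

/-- evaluation homomorphism -/
noncomputable def ev (hB : ∀ᶠ i in Filter.atTop, ‖B ^ i‖ ≤ r ^ i) : WW r hr →ₐ[ℝ] 𝔸 where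
  toFun F := ∑' i, coeff i (F : ℝ⟦X⟧) • B ^ i
  map_one' := by
    rw [tsum_eq_single 0]
    · simp
    · intro i hi; simp [coeff_one, hi]
  map_mul' := by
    intro F G
    rw [tsum_mul_tsum_eq_tsum_sum_antidiagonal_of_summable_norm (ev_norm_summable hB F.2)
      (ev_norm_summable hB G.2)]
    refine tsum_congr fun i => ?_
    rw [MulMemClass.coe_mul, coeff_mul, Finset.sum_smul]
    refine Finset.sum_congr rfl fun x hx => ?_
    rw [← Finset.HasAntidiagonal.mem_antidiagonal.1 hx, pow_add, smul_mul_smul_comm]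
  map_zero' := by simp
  map_add' := by
    intro F G
    rw [← (ev_norm_summable hB F.2).of_norm.tsum_add (ev_norm_summable hB G.2).of_norm]
    refine tsum_congr fun i => ?_
    rw [AddMemClass.coe_add, map_add, add_smul]
  commutes' := by
    intro c
    rw [tsum_eq_single 0]
    · simp [PowerSeries.algebraMap_apply, Algebra.algebraMap_eq_smul_one]
    · intro i hi; simp [PowerSeries.algebraMap_apply, coeff_C, hi]

lemma ev_hasSum (F : WW r hr) : HasSum (fun i => coeff i (F : ℝ⟦X⟧) • B ^ i) (ev hB F) :=
  (ev_norm_summable hB F.2).of_norm.hasSum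

lemma ev_X : ev hB ⟨X, X_mem_WW r hr⟩ = B := by
  change ∑' i, coeff i (X : ℝ⟦X⟧) • B ^ i = B
  rw [tsum_eq_single 1]
  · simp
  · intro i hi; simp [coeff_X, hi]
end

attribute [local instance] Matrix.linftyOpNormedRing Matrix.linftyOpNormedAlgebra

lemma exists_r {n : ℕ} (B : Matrix (Fin n) (Fin n) ℝ)
    (hρ : spectralRadius ℂ (B.map (Complex.ofReal)) < 1) :
    ∃ r : ℝ, 0 ≤ r ∧ r < 1 ∧ ∀ᶠ i in Filter.atTop, ‖B ^ i‖ ≤ r ^ i := by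
  obtain ⟨r, h1, h2⟩ := ENNReal.lt_iff_exists_nnreal_btwn.1 hρ
  refine ⟨r, r.2, by exact_mod_cast h2, ?_⟩
  have h := (spectrum.pow_nnnorm_pow_one_div_tendsto_nhds_spectralRadius
    (B.map (Complex.ofReal))).eventually_lt_const h1
  filter_upwards [h, Filter.eventually_gt_atTop 0] with i hi hi0
  have hmap : (B.map Complex.ofReal) ^ i = (B ^ i).map Complex.ofReal :=
    (Matrix.map_pow (f := Complex.ofRealHom) B i).symm
  have hn : ‖(B.map Complex.ofReal) ^ i‖₊ = ‖B ^ i‖₊ := by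
    rw [hmap, Matrix.linfty_opNNNorm_def, Matrix.linfty_opNNNorm_def]
    simp
  rw [hn] at hi
  have hi' : (0:ℝ) < i := by exact_mod_cast hi0
  have h3 := (ENNReal.rpow_lt_rpow hi hi').le
  rw [← ENNReal.rpow_mul, one_div, inv_mul_cancel₀ hi'.ne', ENNReal.rpow_one,
    ENNReal.rpow_natCast] at h3
  exact_mod_cast h3

theorem main_aux
    (q m : ℕ) (hm : 1 ≤ m)
    (b : ℕ → ℝ) (hb0 : b 0 = 1)
    (hrec : ∀ i : ℕ, ((q : ℝ) + 1) * (i + 1) * b (i + 1) = (((q : ℝ) + 1) * i - 1) * b i)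
    (hneg : ∀ i, b (i + 1) < 0)
    (n : ℕ)
    (B : Matrix (Fin n) (Fin n) ℝ)
    (hBpos : ∀ i j, 0 ≤ B i j)
    (hρ : spectralRadius ℂ (B.map (Complex.ofReal)) < 1)
    (Y : ℕ → Matrix (Fin n) (Fin n) ℝ)
    (hX0 : Y 0 = 1)
    (hX : ∀ k, Y (k + 1) = Y k * ∑ i ∈ Finset.range (m + 1),
      (b i • (1 - (1 - B) * (Y k ^ (q + 1))⁻¹) ^ i)) :
    (∀ k, IsUnit (Y k)) ∧
    Summable (fun i => b i • B ^ i) ∧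
    (∀ k i j, Y (k + 1) i j ≤ Y k i j) ∧
    (∀ k i j, (∑' i', b i' • B ^ i') i j ≤ Y k i j) ∧
    Filter.Tendsto Y Filter.atTop (nhds (∑' i, b i • B ^ i)) := by
  obtain ⟨r, hr, hr1, hB⟩ := exists_r B hρ
  have hxm : ∀ k, xs b q m k ∈ WW r hr := fun k => mem_WW_of_le r hr hr1 fun i =>
    (xs_abs_le hb0 hrec hneg hm k i).trans (b_abs_le hb0 hrec hneg i)
  have hum : ∀ k, (xs b q m k)⁻¹ ∈ WW r hr := fun k => mem_WW_of_le r hr hr1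
    (xs_inv_abs_le hb0 hrec hneg hm k)
  let x : ℕ → WW r hr := fun k => ⟨_, hxm k⟩
  let u : ℕ → WW r hr := fun k => ⟨_, hum k⟩
  let t : WW r hr := ⟨X, X_mem_WW r hr⟩
  have hxu : ∀ k, x k * u k = 1 := fun k => Subtype.ext (xs_mul_inv hb0 k)
  have hx1 : ∀ k, x (k + 1) = x k * ∑ i ∈ Finset.range (m + 1),
      b i • (1 - (1 - t) * u k ^ (q + 1)) ^ i := by
    intro k
    apply Subtype.ext
    change xs b q m (k + 1) = _
    rw [xs_succ, TT, rs]
    simp [x, u, t]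
  have hYx : ∀ k, Y k = ev hB (x k) := by
    intro k
    induction k with
    | zero =>
      have : x 0 = 1 := Subtype.ext rfl
      rw [hX0, this, map_one]
    | succ k ih =>
      have h1 : ev hB (x k) ^ (q + 1) * ev hB (u k) ^ (q + 1) = 1 := by
        rw [← map_pow, ← map_pow, ← map_mul, ← mul_pow, hxu, one_pow, map_one]
      rw [hX, ih, Matrix.inv_eq_right_inv h1, hx1]
      simp only [map_mul, map_sum, map_smul, map_pow, map_sub, map_one]
      rw [ev_X]
  have hBp : ∀ l i j, 0 ≤ (B ^ l) i j := by
    intro l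
    induction l with
    | zero => intro i j; rw [pow_zero, Matrix.one_apply]; split_ifs <;> norm_num
    | succ l ih =>
      intro i j
      rw [pow_succ, Matrix.mul_apply]
      exact Finset.sum_nonneg fun c _ => mul_nonneg (ih i c) (hBpos c j)
  have hsm : mk b ∈ WW r hr := mem_WW_of_le r hr hr1 fun i => by
    rw [coeff_mk]; exact b_abs_le hb0 hrec hneg i
  have hnorm := ev_norm_summable hB hsm
  simp only [coeff_mk] at hnorm
  have hsum : Summable (fun i => b i • B ^ i) := hnorm.of_norm
  have hY : ∀ k, HasSum (fun l => coeff l (xs b q m k) • B ^ l) (Y k) := fun k => by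
    rw [hYx]; exact ev_hasSum hB (x k)
  have hent : ∀ (F : ℕ → ℝ) (M : Matrix (Fin n) (Fin n) ℝ), HasSum (fun l => F l • B ^ l) M →
      ∀ i j, HasSum (fun l => F l * (B ^ l) i j) (M i j) := by
    intro F M h i j
    exact Pi.hasSum.1 (Pi.hasSum.1 h i) j
  refine ⟨fun k => ?_, hsum, fun k i j => ?_, fun k i j => ?_, ?_⟩
  · rw [hYx]
    exact IsUnit.map (ev hB) (IsUnit.of_mul_eq_one _ (hxu k))
  · exact hasSum_le (fun l => mul_le_mul_of_nonneg_right (xs_anti hb0 hrec hneg hm k l)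
      (hBp l i j)) (hent _ _ (hY (k + 1)) i j) (hent _ _ (hY k) i j)
  · exact hasSum_le (fun l => mul_le_mul_of_nonneg_right (xs_ge hb0 hrec hneg hm k l)
      (hBp l i j)) (hent _ _ hsum.hasSum i j) (hent _ _ (hY k) i j)
  · have : Y = fun k => ∑' l, coeff l (xs b q m k) • B ^ l := funext fun k => (hY k).tsum_eq.symm
    rw [this]
    refine tendsto_tsum_of_dominated_convergence hnorm (fun l => ?_) (Filter.Eventually.of_forall
      fun k l => ?_)
    · refine tendsto_const_nhds.congr' ?_
      filter_upwards [Filter.eventually_ge_atTop l] with k hk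
      rw [xs_eq hb0 hrec hm k l hk]
    · rw [norm_smul, norm_smul]
      exact mul_le_mul_of_nonneg_right (xs_abs_le hb0 hrec hneg hm k l) (norm_nonneg _)

end SchroderAux



/-- Monotonic convergence for a nonsingular M-matrix A = I − B with B ≥ 0, ρ(B) < 1:
each X_k is invertible, the sequence is entrywise decreasing, bounded below entrywise by
A^{1/p} = Σ b_i·B^i (a summable family), and converges to A^{1/p}. -/
theorem matrix_schroder_monotone_convergence
    (p m : ℕ) (hp : 2 ≤ p) (hm : 1 ≤ m)
    (b : ℕ → ℝ)
    (hb : ∀ i, b i = (∏ j ∈ Finset.range i, ((j : ℝ) - 1 / p)) / (Nat.factorial i : ℝ))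
    (n : ℕ) (hn : 1 ≤ n)
    (B : Matrix (Fin n) (Fin n) ℝ)
    (hBpos : ∀ i j, 0 ≤ B i j)
    (hρ : spectralRadius ℂ (B.map (Complex.ofReal)) < 1)
    (A : Matrix (Fin n) (Fin n) ℝ) (hA : A = 1 - B)
    (X : ℕ → Matrix (Fin n) (Fin n) ℝ)
    (hX0 : X 0 = 1)
    (hX : ∀ k, X (k + 1) = X k * ∑ i ∈ Finset.range (m + 1),
      (b i • (1 - A * (X k ^ p)⁻¹) ^ i)) :
    (∀ k, IsUnit (X k)) ∧
    Summable (fun i => b i • B ^ i) ∧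
    (∀ k i j, X (k + 1) i j ≤ X k i j) ∧
    (∀ k i j, (∑' i', b i' • B ^ i') i j ≤ X k i j) ∧
    Filter.Tendsto X Filter.atTop (nhds (∑' i, b i • B ^ i)) := by
  obtain ⟨q, rfl⟩ : ∃ q, p = q + 1 := ⟨p - 1, by omega⟩
  have hq : (1 : ℝ) ≤ q := by exact_mod_cast (by omega : 1 ≤ q)
  have hb0 : b 0 = 1 := by simp [hb]
  have hrec : ∀ i : ℕ, ((q : ℝ) + 1) * (i + 1) * b (i + 1) = (((q : ℝ) + 1) * i - 1) * b i := by
    intro i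
    rw [hb, hb, Finset.prod_range_succ, Nat.factorial_succ]
    have h1 : (Nat.factorial i : ℝ) ≠ 0 := by positivity
    have h2 : (q : ℝ) + 1 ≠ 0 := by positivity
    have h3 : (i : ℝ) + 1 ≠ 0 := by positivity
    push_cast
    field_simp
  have hneg : ∀ i, b (i + 1) < 0 := by
    intro i
    induction i with
    | zero =>
      have h := hrec 0
      rw [hb0] at h
      push_cast at h
      by_contra hc
      push Not at hc
      simp only [zero_add] at h hc
      nlinarith
    | succ i ih =>
      have h := hrec (i + 1)
      push_cast at h
      by_contra hc
      push Not at hc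
      have h1 : 0 ≤ ((q : ℝ) + 1) * (i + 1 + 1) * b (i + 1 + 1) := by positivity
      have h2 : 0 < ((q : ℝ) + 1) * (i + 1) - 1 := by
        have : (0:ℝ) ≤ i := Nat.cast_nonneg i
        nlinarith
      nlinarith
  subst hA
  exact SchroderAux.main_aux q m hm b hb0 hrec hneg n B hBpos hρ X hX0 hX
end

section
/- For every k ≥ 0, the matrix C_k := I − X_k has all entries nonnegative and spectral radius ρ(C_k) < 1; in particular each X_k is a nonsingular M-matrix with diagonal entries in (0,1]. -/
open PowerSeries in
/-- Coefficientwise nonnegativity of a formal power series. -/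
def SchNN (φ : PowerSeries ℝ) : Prop := ∀ n, 0 ≤ coeff n φ

lemma SchNN.add {φ ψ : PowerSeries ℝ} (h : SchNN φ) (h' : SchNN ψ) : SchNN (φ + ψ) := fun n => by
  rw [map_add]; exact add_nonneg (h n) (h' n)

lemma SchNN.mul {φ ψ : PowerSeries ℝ} (h : SchNN φ) (h' : SchNN ψ) : SchNN (φ * ψ) := fun n => by
  rw [PowerSeries.coeff_mul]; exact Finset.sum_nonneg fun x _ => mul_nonneg (h _) (h' _)

lemma SchNN.one : SchNN 1 := fun n => by
  rw [PowerSeries.coeff_one]; split_ifs <;> norm_num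

lemma SchNN.X : SchNN PowerSeries.X := fun n => by
  rw [PowerSeries.coeff_X]; split_ifs <;> norm_num

lemma SchNN.C {c : ℝ} (hc : 0 ≤ c) : SchNN (PowerSeries.C c) := fun n => by
  rw [PowerSeries.coeff_C]; split_ifs <;> simp [hc]

lemma SchNN.pow {φ : PowerSeries ℝ} (h : SchNN φ) (k : ℕ) : SchNN (φ ^ k) := by
  induction k with
  | zero => simpa using SchNN.one
  | succ k ih => rw [pow_succ]; exact ih.mul h

lemma sch_inv_coeff {S V : PowerSeries ℝ} (hV : (1 - S) * V = 1) (n : ℕ) :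
    PowerSeries.coeff n V = (if n = 0 then 1 else 0) +
      ∑ x ∈ Finset.HasAntidiagonal.antidiagonal n, PowerSeries.coeff x.1 S * PowerSeries.coeff x.2 V := by
  have : V = 1 + S * V := by linear_combination hV
  conv_lhs => rw [this]
  rw [map_add, PowerSeries.coeff_one, PowerSeries.coeff_mul]

lemma sch_inv_nn {S V : PowerSeries ℝ} (hS : SchNN S) (h0 : PowerSeries.coeff 0 S = 0)
    (hV : (1 - S) * V = 1) : SchNN V := by
  intro n
  induction n using Nat.strong_induction_on with
  | _ n ih =>
    rw [sch_inv_coeff hV]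
    refine add_nonneg (by split_ifs <;> norm_num) (Finset.sum_nonneg fun x hx => ?_)
    rw [Finset.HasAntidiagonal.mem_antidiagonal] at hx
    rcases Nat.eq_zero_or_pos x.1 with h | h
    · rw [h, h0, zero_mul]
    · exact mul_nonneg (hS _) (ih _ (by omega))

lemma sch_inv_le {S V : PowerSeries ℝ} (hS : SchNN S) (h0 : PowerSeries.coeff 0 S = 0)
    (hS1 : ∀ n, ∑ i ∈ Finset.range (n + 1), PowerSeries.coeff i S ≤ 1)
    (hV : (1 - S) * V = 1) (n : ℕ) : PowerSeries.coeff n V ≤ 1 := by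
  induction n using Nat.strong_induction_on with
  | _ n ih =>
    rw [sch_inv_coeff hV]
    rcases Nat.eq_zero_or_pos n with h | h
    · subst h; simp [h0, PowerSeries.coeff_zero_eq_constantCoeff] at *
    · rw [if_neg (by omega), zero_add]
      refine le_trans ?_ (hS1 n)
      rw [← Finset.Nat.sum_antidiagonal_eq_sum_range_succ (fun i _ => PowerSeries.coeff i S)]
      refine Finset.sum_le_sum fun x hx => ?_
      rw [Finset.HasAntidiagonal.mem_antidiagonal] at hx
      rcases Nat.eq_zero_or_pos x.1 with h | h
      · rw [h, h0, zero_mul]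
      · exact mul_le_of_le_one_right (hS _) (ih _ (by omega))

lemma sch_b_facts (p : ℕ) (hp : 2 ≤ p) (b : ℕ → ℝ)
    (hb : ∀ i, b i = (∏ j ∈ Finset.range i, ((j : ℝ) - 1 / p)) / (Nat.factorial i : ℝ)) :
    b 0 = 1 ∧ (∀ i : ℕ, ((i : ℝ) + 1) * b (i + 1) = ((i : ℝ) - 1 / p) * b i) ∧
    (∀ i : ℕ, b (i + 1) ≤ 0) ∧
    (∀ k, 0 ≤ ∑ i ∈ Finset.range (k + 1), b i) := by
  have hp' : (2 : ℝ) ≤ p := by exact_mod_cast hp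
  have hp1 : (1 : ℝ) / p ≤ 1 / 2 := by gcongr
  have hp0 : (0 : ℝ) < 1 / p := by positivity
  have h0 : b 0 = 1 := by simp [hb]
  have hrec : ∀ i : ℕ, ((i : ℝ) + 1) * b (i + 1) = ((i : ℝ) - 1 / p) * b i := by
    intro i
    rw [hb, hb, Finset.prod_range_succ, Nat.factorial_succ]
    have : (i.factorial : ℝ) ≠ 0 := by positivity
    have h1 : ((i : ℝ) + 1) ≠ 0 := by positivity
    push_cast
    generalize (∏ j ∈ Finset.range i, ((j : ℝ) - 1 / p)) = Q
    generalize ((i : ℝ) - 1 / p) = Z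
    field_simp
  have hneg : ∀ i : ℕ, b (i + 1) ≤ 0 := by
    intro i
    induction i with
    | zero => have := hrec 0; simp [h0] at this ⊢; rw [this]; simp
    | succ i ih =>
      have := hrec (i + 1)
      push_cast at this
      have h2 : ((i : ℝ) + 1 - 1 / p) * b (i + 1) ≤ 0 :=
        mul_nonpos_of_nonneg_of_nonpos (by have : (0:ℝ) ≤ i := by positivity
                                           linarith) ih
      rw [← this] at h2
      by_contra hc
      push Not at hc
      have : (0 : ℝ) < ((i : ℝ) + 1 + 1) * b (i + 1 + 1) := by positivity
      linarith
  refine ⟨h0, hrec, hneg, fun k => ?_⟩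
  have key : ∑ i ∈ Finset.range (k + 1), b i = - p * ((k + 1) * b (k + 1)) := by
    induction k with
    | zero => simp [h0]; have := hrec 0; simp [h0] at this; rw [this]; field_simp
    | succ k ih =>
      rw [Finset.sum_range_succ, ih, hrec (k+1)]
      push_cast
      field_simp
      ring
  rw [key]
  have := hneg k
  have h3 : ((k : ℝ) + 1) * b (k + 1) ≤ 0 := mul_nonpos_of_nonneg_of_nonpos (by positivity) this
  nlinarith

lemma sch_formal (p m : ℕ) (hp : 2 ≤ p) (hm : 1 ≤ m) (b : ℕ → ℝ)
    (hb : ∀ i, b i = (∏ j ∈ Finset.range i, ((j : ℝ) - 1 / p)) / (Nat.factorial i : ℝ)) :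
    ∃ T W : PowerSeries ℝ, (∀ i, PowerSeries.coeff i T = if i ≤ m then b i else 0) ∧
      SchNN (1 - T) ∧
      T * W = 1 ∧ SchNN W ∧ (∀ n, PowerSeries.coeff n W ≤ 1) ∧
      SchNN (1 - (1 - PowerSeries.X) * W ^ p) ∧
      (∃ h, SchNN h ∧ T * (1 - (1 - PowerSeries.X) * W ^ p) = PowerSeries.X * h) ∧
      SchNN (T ^ p * PowerSeries.mk 1) ∧
      ((1 - PowerSeries.X) * W ^ p) * (T ^ p * PowerSeries.mk 1) = 1 := by
  obtain ⟨hb0, hrec, hneg, hsum⟩ := sch_b_facts p hp b hb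
  obtain ⟨q, rfl⟩ : ∃ q, p = q + 1 := ⟨p - 1, by omega⟩
  obtain ⟨m, rfl⟩ : ∃ k, m = k + 1 := ⟨m - 1, by omega⟩
  set P : ℝ := ((q + 1 : ℕ) : ℝ) with hP
  have hP2 : 2 ≤ P := by rw [hP]; exact_mod_cast hp
  have hPq : P = q + 1 := by rw [hP]; push_cast; rfl
  set T : PowerSeries ℝ := PowerSeries.mk fun i => if i ≤ m + 1 then b i else 0 with hT
  have cT : ∀ i, PowerSeries.coeff i T = if i ≤ m + 1 then b i else 0 := fun i => by
    rw [hT, PowerSeries.coeff_mk]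
  have cT0 : PowerSeries.constantCoeff T = 1 := by
    rw [← PowerSeries.coeff_zero_eq_constantCoeff_apply, cT]; simp [hb0]
  set W := T⁻¹ with hW
  have hTW : T * W = 1 := PowerSeries.mul_inv_cancel _ (by rw [cT0]; norm_num)
  have cS : ∀ i, PowerSeries.coeff i (1 - T) = if i = 0 then 0 else if i ≤ m + 1 then - b i else 0 := by
    intro i
    rw [map_sub, cT, PowerSeries.coeff_one]
    rcases i with _ | i
    · simp [hb0]
    · by_cases h : i + 1 ≤ m + 1 <;> simp [h]
  have hS : SchNN (1 - T) := by
    intro i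
    rw [cS]
    rcases i with _ | i
    · simp
    · have := hneg i
      split_ifs <;> simp [this]
  have hS0 : PowerSeries.coeff 0 (1 - T) = 0 := by rw [cS]; simp
  have hSW : (1 - (1 - T)) * W = 1 := by rw [sub_sub_cancel, hTW]
  have hWnn : SchNN W := sch_inv_nn hS hS0 hSW
  have hTsum : ∀ n, 0 ≤ ∑ i ∈ Finset.range (n + 1), PowerSeries.coeff i T := by
    intro n
    induction n with
    | zero => simp [cT, hb0]
    | succ n ih =>
      by_cases h : n + 1 ≤ m + 1
      · have : ∀ i ∈ Finset.range (n + 1 + 1), PowerSeries.coeff i T = b i := fun i hi => by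
          rw [cT, if_pos]; rw [Finset.mem_range] at hi; omega
        rw [Finset.sum_congr rfl this]; exact hsum _
      · rw [Finset.sum_range_succ, cT (n+1), if_neg h, add_zero]; exact ih
  have hWle : ∀ n, PowerSeries.coeff n W ≤ 1 := by
    refine sch_inv_le hS hS0 (fun n => ?_) hSW
    have := hTsum n
    simp only [map_sub, Finset.sum_sub_distrib]
    have h1 : ∑ i ∈ Finset.range (n + 1), PowerSeries.coeff i (1 : PowerSeries ℝ) = 1 := by
      simp [PowerSeries.coeff_one]
    rw [h1]; linarith
  set D := PowerSeries.derivative ℝ with hD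
  set c : ℝ := -(P * (m + 1) - 1) * b (m + 1) with hc
  have hc0 : 0 ≤ c := by
    have := hneg m
    have h2 : (0:ℝ) ≤ m := by positivity
    have : 0 ≤ P * (m + 1) - 1 := by nlinarith
    rw [hc]; nlinarith
  have hode : T + PowerSeries.C P * (1 - PowerSeries.X) * D T
      = PowerSeries.C c * PowerSeries.X ^ (m + 1) := by
    have : T + PowerSeries.C P * (1 - PowerSeries.X) * D T
      = T + PowerSeries.C P * D T - PowerSeries.C P * (PowerSeries.X * D T) := by ring
    rw [this]
    ext n
    simp only [map_sub, map_add, PowerSeries.coeff_C_mul, PowerSeries.coeff_X_pow]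
    rcases n with _ | n
    · have := hrec 0
      simp [hD, cT, PowerSeries.coeff_derivative, hb0] at this ⊢
      rw [this]; field_simp; norm_num
    · rw [PowerSeries.coeff_succ_X_mul, hD, PowerSeries.coeff_derivative,
        PowerSeries.coeff_derivative, cT, cT]
      rcases lt_trichotomy n m with h | h | h
      · have := hrec (n + 1)
        rw [if_pos (by omega), if_pos (by omega), if_neg (by omega)]
        push_cast at this ⊢
        have h3 : b (n + 1 + 1) * ((n : ℝ) + 1 + 1) = (n + 1 - 1 / P) * b (n + 1) := by
          rw [← this]; ring
        rw [h3]; field_simp; ring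
      · subst h
        rw [if_pos (by omega), if_neg (by omega), if_pos rfl, hc]
        ring
      · rw [if_neg (by omega), if_neg (by omega), if_neg (by omega)]
        ring
  have hDW : D W = - W ^ 2 * D T := PowerSeries.derivative_inv' T
  have hDpow : ∀ k : ℕ, D (W ^ k) = - PowerSeries.C (k : ℝ) * W ^ (k + 1) * D T := by
    intro k
    rcases k with _ | k
    · simp [hD]
    · rw [hD, PowerSeries.derivative_pow, ← hD, hDW]
      simp
      ring
  have hDX : D (1 - PowerSeries.X) = -1 := by
    rw [map_sub, hD, PowerSeries.derivative_X, PowerSeries.derivative_one]; ring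
  have hfder : D (1 - (1 - PowerSeries.X) * W ^ (q + 1)) =
      PowerSeries.C c * W ^ (q + 2) * PowerSeries.X ^ (m + 1) := by
    rw [map_sub, hD, PowerSeries.derivative_one, ← hD, Derivation.leibniz, hDpow, hDX]
    simp only [smul_eq_mul]
    have h1 : W ^ (q + 1) = W ^ (q + 2) * T := by
      rw [pow_succ W (q + 1)]; linear_combination (-W^(q+1)) * hTW
    rw [← hP]
    linear_combination W ^ (q + 2) * hode + h1
  have cW0 : PowerSeries.constantCoeff W = 1 := by
    have := congrArg (PowerSeries.constantCoeff) hTW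
    simpa [cT0] using this
  set f := 1 - (1 - PowerSeries.X) * W ^ (q + 1) with hf
  have hf0 : PowerSeries.coeff 0 f = 0 := by
    simp [hf, cW0]
  have hderiv_succ : ∀ (g : PowerSeries ℝ) (n : ℕ),
      PowerSeries.coeff (n + 1) g = PowerSeries.coeff n (D g) / (n + 1) := by
    intro g n
    rw [hD, PowerSeries.coeff_derivative]; field_simp
  have hfnn : SchNN f := by
    intro n
    rcases n with _ | n
    · rw [hf0]
    · rw [hderiv_succ, hfder]
      exact div_nonneg ((((SchNN.C hc0).mul (hWnn.pow _)).mul (SchNN.X.pow _)) n) (by positivity)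
  have hfdvd : (PowerSeries.X : PowerSeries ℝ) ^ (m + 2) ∣ f := by
    rw [PowerSeries.X_pow_dvd_iff]
    intro n hn
    rcases n with _ | n
    · exact hf0
    · rw [hderiv_succ, hfder, PowerSeries.coeff_mul_X_pow', if_neg (by omega), zero_div]
  have hgder : D ((1 - PowerSeries.X) * W ^ q) =
      - (PowerSeries.C (1 / P) * W ^ q +
        PowerSeries.C (c * (1 - 1 / P)) * W ^ (q + 1) * PowerSeries.X ^ (m + 1)) := by
    rw [Derivation.leibniz, hDpow, hDX]
    simp only [smul_eq_mul]
    have h1 : W ^ q = W ^ (q + 1) * T := by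
      rw [pow_succ W q]; linear_combination (-W^q) * hTW
    have e1 : PowerSeries.C (q : ℝ) = PowerSeries.C (1 - 1 / P) * PowerSeries.C P := by
      rw [← map_mul]; congr 1; rw [hPq]; field_simp; ring
    have e2 : PowerSeries.C (1 / P) = 1 - PowerSeries.C (1 - 1 / P) := by
      rw [← map_one PowerSeries.C, ← map_sub]; congr 1; ring
    rw [map_mul, e1, e2]
    linear_combination (-PowerSeries.C (1 - 1 / P) * W ^ (q+1)) * hode
      - (PowerSeries.C (1 - 1 / P)) * h1
  have hTf : T * f = T - (1 - PowerSeries.X) * W ^ q := by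
    rw [hf, pow_succ]; linear_combination (-(1 - PowerSeries.X) * W ^ q) * hTW
  have hTfnn : SchNN (T * f) := by
    intro n
    by_cases hn : n < m + 2
    · rw [(PowerSeries.X_pow_dvd_iff.1 (Dvd.dvd.mul_left hfdvd T)) n hn]
    · obtain ⟨n, rfl⟩ : ∃ k, n = k + 1 := ⟨n - 1, by omega⟩
      rw [hTf, map_sub, cT, if_neg (by omega), hderiv_succ, hgder, map_neg, neg_div, sub_neg_eq_add,
        zero_add]
      have h1P : 1 / P ≤ 1 := by rw [div_le_one (by linarith)]; linarith
      refine div_nonneg ?_ (by positivity)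
      exact (((SchNN.C (by positivity)).mul (hWnn.pow _)).add
        (((SchNN.C (mul_nonneg hc0 (by linarith))).mul (hWnn.pow _)).mul (SchNN.X.pow _))) n
  have hmk : (PowerSeries.mk 1 : PowerSeries ℝ) * (1 - PowerSeries.X) = 1 :=
    PowerSeries.mk_one_mul_one_sub_eq_one ℝ
  have hV : ((1 - PowerSeries.X) * W ^ (q + 1)) * (T ^ (q + 1) * PowerSeries.mk 1) = 1 := by
    have h1 : T ^ (q + 1) * W ^ (q + 1) = 1 := by rw [← mul_pow, hTW, one_pow]
    linear_combination (PowerSeries.mk 1 : PowerSeries ℝ) * (1 - PowerSeries.X) * h1 + hmk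
  refine ⟨T, W, cT, hS, hTW, hWnn, hWle, hfnn, ?_, ?_, hV⟩
  · obtain ⟨h, hh⟩ : (PowerSeries.X : PowerSeries ℝ) ∣ T * f :=
      Dvd.dvd.mul_left ((dvd_pow_self _ (by omega)).trans hfdvd) T
    refine ⟨h, fun n => ?_, hh⟩
    have := hTfnn (n + 1)
    rwa [hh, PowerSeries.coeff_succ_X_mul] at this
  · refine sch_inv_nn hfnn hf0 ?_
    rw [hf, sub_sub_cancel]; exact hV

/-- Evaluation of an absolutely convergent power series at an element of a normed algebra. -/
def SchEv {R : Type*} [NormedRing R] [NormedAlgebra ℝ R] (a : R) (φ : PowerSeries ℝ) (M : R) :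
    Prop :=
  Summable (fun i => ‖PowerSeries.coeff i φ • a ^ i‖) ∧
    HasSum (fun i => PowerSeries.coeff i φ • a ^ i) M

section
variable {R : Type*} [NormedRing R] [NormedAlgebra ℝ R] {a : R}

lemma SchEv.add {φ ψ : PowerSeries ℝ} {M N : R} (h : SchEv a φ M) (h' : SchEv a ψ N) :
    SchEv a (φ + ψ) (M + N) := by
  refine ⟨Summable.of_nonneg_of_le (fun _ => norm_nonneg _) (fun i => ?_) (h.1.add h'.1), ?_⟩
  · rw [map_add, add_smul]; exact norm_add_le _ _
  · simpa only [map_add, add_smul] using h.2.add h'.2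

lemma SchEv.neg {φ : PowerSeries ℝ} {M : R} (h : SchEv a φ M) : SchEv a (-φ) (-M) := by
  refine ⟨?_, ?_⟩
  · simpa only [map_neg, neg_smul, norm_neg] using h.1
  · simpa only [map_neg, neg_smul] using h.2.neg

lemma SchEv.sub {φ ψ : PowerSeries ℝ} {M N : R} (h : SchEv a φ M) (h' : SchEv a ψ N) :
    SchEv a (φ - ψ) (M - N) := by
  rw [sub_eq_add_neg, sub_eq_add_neg]; exact h.add h'.neg

lemma SchEv.mul [CompleteSpace R] {φ ψ : PowerSeries ℝ} {M N : R} (h : SchEv a φ M)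
    (h' : SchEv a ψ N) : SchEv a (φ * ψ) (M * N) := by
  have e : ∀ n, PowerSeries.coeff n (φ * ψ) • a ^ n = ∑ x ∈ Finset.HasAntidiagonal.antidiagonal n,
      (PowerSeries.coeff x.1 φ • a ^ x.1) * (PowerSeries.coeff x.2 ψ • a ^ x.2) := by
    intro n
    rw [PowerSeries.coeff_mul, Finset.sum_smul]
    refine Finset.sum_congr rfl fun x hx => ?_
    rw [Finset.HasAntidiagonal.mem_antidiagonal] at hx
    rw [smul_mul_smul_comm, ← pow_add, hx]
  have s := summable_norm_sum_mul_antidiagonal_of_summable_norm h.1 h'.1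
  have t := tsum_mul_tsum_eq_tsum_sum_antidiagonal_of_summable_norm h.1 h'.1
  unfold SchEv
  simp only [e]
  refine ⟨s, ?_⟩
  rw [← h.2.tsum_eq, ← h'.2.tsum_eq, t]
  exact s.of_norm.hasSum

lemma SchEv.of_fin {φ : PowerSeries ℝ} (m : ℕ) (h : ∀ i, m < i → PowerSeries.coeff i φ = 0) :
    SchEv a φ (∑ i ∈ Finset.range (m + 1), PowerSeries.coeff i φ • a ^ i) := by
  have hz : ∀ i ∉ Finset.range (m + 1), PowerSeries.coeff i φ • a ^ i = 0 := fun i hi => by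
    rw [Finset.mem_range] at hi
    rw [h i (by omega), zero_smul]
  exact ⟨summable_of_ne_finset_zero (s := Finset.range (m + 1)) fun i hi => by rw [hz i hi, norm_zero],
    hasSum_sum_of_ne_finset_zero hz⟩

lemma SchEv.one : SchEv a 1 1 := by
  have := SchEv.of_fin (a := a) (φ := 1) 0 (fun i hi => by
    rw [PowerSeries.coeff_one, if_neg (by omega)])
  simpa using this

lemma SchEv.X : SchEv a PowerSeries.X a := by
  have := SchEv.of_fin (a := a) (φ := PowerSeries.X) 1 (fun i hi => by
    rw [PowerSeries.coeff_X, if_neg (by omega)])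
  simpa [Finset.sum_range_succ, PowerSeries.coeff_X] using this

lemma SchEv.pow [CompleteSpace R] {φ : PowerSeries ℝ} {M : R} (h : SchEv a φ M) (k : ℕ) :
    SchEv a (φ ^ k) (M ^ k) := by
  induction k with
  | zero => simpa using SchEv.one
  | succ k ih => rw [pow_succ, pow_succ]; exact ih.mul h

lemma SchEv.sum {k : ℕ} {φ : ℕ → PowerSeries ℝ} {M : ℕ → R} (h : ∀ i, SchEv a (φ i) (M i)) :
    SchEv a (∑ i ∈ Finset.range k, φ i) (∑ i ∈ Finset.range k, M i) := by
  induction k with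
  | zero => simp only [Finset.range_zero, Finset.sum_empty]
            simpa using (SchEv.one (a := a)).sub SchEv.one
  | succ k ih => rw [Finset.sum_range_succ, Finset.sum_range_succ]; exact ih.add (h k)

lemma SchEv.unique {φ : PowerSeries ℝ} {M N : R} (h : SchEv a φ M) (h' : SchEv a φ N) : M = N :=
  h.2.unique h'.2

lemma SchEv.of_bdd [CompleteSpace R] (ha : Summable fun i => ‖a ^ i‖) {φ : PowerSeries ℝ}
    (h : ∀ i, |PowerSeries.coeff i φ| ≤ 1) : ∃ M, SchEv a φ M := by
  have s : Summable (fun i => ‖PowerSeries.coeff i φ • a ^ i‖) :=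
    Summable.of_nonneg_of_le (fun _ => norm_nonneg _) (fun i => by
      rw [norm_smul, Real.norm_eq_abs]
      exact mul_le_of_le_one_left (norm_nonneg _) (h i)) ha
  exact ⟨_, s, s.of_norm.hasSum⟩
end

/-- Entrywise nonnegative matrices. -/
def SchPos {n : ℕ} (M : Matrix (Fin n) (Fin n) ℝ) : Prop := ∀ i j, 0 ≤ M i j

section
variable {n : ℕ} {M N : Matrix (Fin n) (Fin n) ℝ}

lemma SchPos.add (h : SchPos M) (h' : SchPos N) : SchPos (M + N) := fun i j =>
  add_nonneg (h i j) (h' i j)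

lemma SchPos.mul (h : SchPos M) (h' : SchPos N) : SchPos (M * N) := fun i j => by
  rw [Matrix.mul_apply]; exact Finset.sum_nonneg fun x _ => mul_nonneg (h _ _) (h' _ _)

lemma SchPos.one : SchPos (1 : Matrix (Fin n) (Fin n) ℝ) := fun i j => by
  rw [Matrix.one_apply]; split_ifs <;> norm_num

lemma SchPos.smul {c : ℝ} (hc : 0 ≤ c) (h : SchPos M) : SchPos (c • M) := fun i j => by
  rw [Matrix.smul_apply]; exact mul_nonneg hc (h i j)

lemma SchPos.sum {ι : Type*} {s : Finset ι} {F : ι → Matrix (Fin n) (Fin n) ℝ}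
    (h : ∀ i ∈ s, SchPos (F i)) : SchPos (∑ i ∈ s, F i) := fun i j => by
  rw [Matrix.sum_apply]; exact Finset.sum_nonneg fun x hx => h x hx i j

lemma SchPos.pow (h : SchPos M) (k : ℕ) : SchPos (M ^ k) := by
  induction k with
  | zero => simpa using SchPos.one
  | succ k ih => rw [pow_succ]; exact ih.mul h
end

section
attribute [local instance] Matrix.linftyOpNormedRing Matrix.linftyOpNormedAlgebra

lemma SchEv.pos {n : ℕ} {B M : Matrix (Fin n) (Fin n) ℝ} {φ : PowerSeries ℝ}
    (h : SchEv B φ M) (hφ : SchNN φ) (hB : SchPos B) : SchPos M := by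
  intro i j
  have h1 : HasSum (fun k => (PowerSeries.coeff k φ • B ^ k) i j) (M i j) := by
    have := (Pi.hasSum.1 h.2) i
    exact (Pi.hasSum.1 this) j
  exact h1.nonneg fun k => ((hB.pow k).smul (hφ k)) i j

lemma sch_norm_le {n : ℕ} (M : Matrix (Fin n) (Fin n) ℝ) : ‖M‖ ≤ ∑ i, ∑ j, |M i j| := by
  rw [Matrix.linfty_opNorm_def]
  have : (Finset.univ.sup fun i => ∑ j, ‖M i j‖₊) ≤ ∑ i, ∑ j, ‖M i j‖₊ :=
    Finset.sup_le fun i hi =>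
      Finset.single_le_sum (f := fun i => ∑ j, ‖M i j‖₊) (fun _ _ => zero_le) hi
  have h2 : ((∑ i, ∑ j, ‖M i j‖₊ : NNReal) : ℝ) = ∑ i, ∑ j, |M i j| := by
    push_cast; simp
  rw [← h2]
  exact_mod_cast this

lemma sch_summable_of_inv {n : ℕ} {N H : Matrix (Fin n) (Fin n) ℝ} (hN : SchPos N) (hH : SchPos H)
    (h : (1 - N) * H = 1) : Summable fun k => ‖N ^ k‖ := by
  have key : ∀ K, ∑ k ∈ Finset.range K, N ^ k = H - N ^ K * H := by
    intro K
    have := geom_sum_mul_neg N K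
    calc ∑ k ∈ Finset.range K, N ^ k = (∑ k ∈ Finset.range K, N ^ k) * ((1 - N) * H) := by
          rw [h, mul_one]
      _ = _ := by rw [← mul_assoc, this, sub_mul, one_mul]
  have hs : ∀ i j, Summable fun k => (N ^ k) i j := by
    intro i j
    refine summable_of_sum_range_le (c := H i j) (fun k => hN.pow k i j) fun K => ?_
    have h1 := congrFun (congrFun (key K) i) j
    rw [Matrix.sum_apply, Matrix.sub_apply] at h1
    rw [h1]
    have := ((hN.pow K).mul hH) i j
    linarith
  refine Summable.of_nonneg_of_le (fun _ => norm_nonneg _) (fun k => sch_norm_le (N ^ k)) ?_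
  exact summable_sum fun i _ => summable_sum fun j _ => (hs i j).abs

lemma sch_norm_map {n : ℕ} (M : Matrix (Fin n) (Fin n) ℝ) :
    ‖M.map Complex.ofReal‖ = ‖M‖ := by
  rw [Matrix.linfty_opNorm_def, Matrix.linfty_opNorm_def]
  simp

lemma sch_map_pow {n : ℕ} (M : Matrix (Fin n) (Fin n) ℝ) (k : ℕ) :
    (M ^ k).map Complex.ofReal = (M.map Complex.ofReal) ^ k := by
  exact map_pow (Complex.ofRealHom.mapMatrix) M k

lemma sch_summable_of_radius {n : ℕ} {M : Matrix (Fin n) (Fin n) ℝ}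
    (h : spectralRadius ℂ (M.map Complex.ofReal) < 1) : Summable fun k => ‖M ^ k‖ := by
  obtain ⟨r, hr1, hr2⟩ := exists_between h
  have hr : r ≠ ⊤ := (hr2.trans ENNReal.one_lt_top).ne
  lift r to NNReal using hr
  have ht := spectrum.pow_nnnorm_pow_one_div_tendsto_nhds_spectralRadius (M.map Complex.ofReal)
  have hr3 : (r : ℝ) < 1 := by exact_mod_cast hr2
  have hg : Summable fun k : ℕ => (r : ℝ) ^ k := summable_geometric_of_lt_one r.2 hr3
  refine Summable.of_norm_bounded_eventually_nat hg ?_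
  filter_upwards [ht.eventually_lt_const hr1, Filter.eventually_ge_atTop 1] with k hk hk1
  have hk' : (0 : ℝ) < k := by exact_mod_cast hk1
  rw [one_div, ENNReal.rpow_inv_lt_iff hk'] at hk
  rw [norm_norm, ← sch_norm_map, sch_map_pow]
  have : (‖(M.map Complex.ofReal) ^ k‖₊ : ENNReal) < ((r ^ k : NNReal) : ENNReal) := by
    simpa using hk
  have h2 : ‖(M.map Complex.ofReal) ^ k‖₊ < r ^ k := by exact_mod_cast this
  exact_mod_cast h2.le

lemma sch_radius_of_summable {n : ℕ} {M : Matrix (Fin n) (Fin n) ℝ}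
    (h : Summable fun k => ‖M ^ k‖) : spectralRadius ℂ (M.map Complex.ofReal) < 1 := by
  rcases Nat.eq_zero_or_pos n with hn | hn
  · subst hn
    rw [spectrum.SpectralRadius.of_subsingleton]; exact one_pos
  have : Nonempty (Fin n) := ⟨⟨0, hn⟩⟩
  have ht := (h.tendsto_atTop_zero.comp (Filter.tendsto_add_atTop_nat 1)).eventually_lt_const one_pos
  obtain ⟨k, hk⟩ := ht.exists
  refine lt_of_le_of_lt (spectrum.spectralRadius_le_pow_nnnorm_pow_one_div ℂ _ k) ?_
  have h1 : ‖(M.map Complex.ofReal) ^ (k + 1)‖₊ < 1 := by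
    have : ‖(M.map Complex.ofReal) ^ (k + 1)‖ < 1 := by
      rw [← sch_map_pow, sch_norm_map]; exact hk
    exact_mod_cast this
  have h2 : ‖(1 : Matrix (Fin n) (Fin n) ℂ)‖₊ = 1 := by
    have : ‖(1 : Matrix (Fin n) (Fin n) ℂ)‖ = 1 := by
      rw [Matrix.linfty_opNorm_def]
      have h3 : ∀ i : Fin n, ∑ j, ‖(1 : Matrix (Fin n) (Fin n) ℂ) i j‖₊ = 1 := by
        intro i
        rw [Finset.sum_eq_single i]
        · simp
        · intro j _ hj
          simp [Matrix.one_apply_ne hj.symm]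
        · simp
      simp only [h3]
      rw [Finset.sup_const Finset.univ_nonempty]
      simp
    exact NNReal.eq (by simpa using this)
  rw [h2]
  simp only [ENNReal.coe_one, ENNReal.one_rpow, mul_one]
  exact ENNReal.rpow_lt_one (by exact_mod_cast h1) (by positivity)

lemma sch_matrix_step (p m : ℕ) (hp : 2 ≤ p) (hm : 1 ≤ m) (b : ℕ → ℝ)
    (hb : ∀ i, b i = (∏ j ∈ Finset.range i, ((j : ℝ) - 1 / p)) / (Nat.factorial i : ℝ))
    {n : ℕ} {B : Matrix (Fin n) (Fin n) ℝ} (hB : SchPos B) (hs : Summable fun k => ‖B ^ k‖)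
    {TB WB FB : Matrix (Fin n) (Fin n) ℝ}
    (hTB : TB = ∑ i ∈ Finset.range (m + 1), b i • B ^ i) (hWB : WB = TB⁻¹)
    (hFB : FB = 1 - (1 - B) * WB ^ p) :
    TB * WB = 1 ∧ SchPos WB ∧ SchPos FB ∧ (Summable fun k => ‖FB ^ k‖) ∧
    (∃ h, SchPos h ∧ TB * FB = B * h) ∧ ∃ h, SchPos h ∧ 1 - TB = B * h := by
  obtain ⟨T, W, cT, hS, hTW, hW, hW1, hf, ⟨h, hh, hTf⟩, hV, hfV⟩ := sch_formal p m hp hm b hb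
  obtain ⟨hb0, -, hneg, -⟩ := sch_b_facts p hp b hb
  have eT : SchEv B T TB := by
    have := SchEv.of_fin (a := B) (φ := T) m (fun i hi => by rw [cT, if_neg (by omega)])
    rw [hTB]
    convert this using 1
    refine Finset.sum_congr rfl fun i hi => ?_
    rw [Finset.mem_range] at hi
    rw [cT, if_pos (by omega)]
  obtain ⟨W', eW⟩ := SchEv.of_bdd hs (φ := W) (fun i => by rw [abs_of_nonneg (hW i)]; exact hW1 i)
  have hTW' : TB * W' = 1 := by
    have e1 := eT.mul eW
    rw [hTW] at e1
    exact e1.unique SchEv.one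
  have hWW : WB = W' := by rw [hWB]; exact Matrix.inv_eq_right_inv hTW'
  rw [← hWW] at eW hTW'
  have eF : SchEv B (1 - (1 - PowerSeries.X) * W ^ p) FB := by
    rw [hFB]; exact SchEv.one.sub ((SchEv.one.sub SchEv.X).mul (eW.pow p))
  have hFpos : SchPos FB := eF.pos hf hB
  obtain ⟨G, eG⟩ := SchEv.of_bdd hs (φ := PowerSeries.mk 1) (fun i => by simp)
  have eV := (eT.pow p).mul eG
  have hFH : (1 - FB) * (TB ^ p * G) = 1 := by
    have e1 : SchEv B ((1 - PowerSeries.X) * W ^ p) (1 - FB) := by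
      have := (SchEv.one (a := B)).sub eF
      rwa [sub_sub_cancel] at this
    have e2 := e1.mul eV
    rw [hfV] at e2
    exact e2.unique SchEv.one
  refine ⟨hTW', eW.pos hW hB, hFpos, sch_summable_of_inv hFpos (eV.pos hV hB) hFH, ?_, ?_⟩
  · obtain ⟨Z, eZ⟩ := SchEv.of_bdd hs (φ := PowerSeries.mk fun i => PowerSeries.coeff (i + 1) W)
      (fun i => by rw [PowerSeries.coeff_mk, abs_of_nonneg (hW _)]; exact hW1 _)
    have eh' := eT.mul ((eW.pow p).sub (eZ.mul (SchEv.sum (k := p) (fun i => eW.pow i))))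
    have cT0 : PowerSeries.constantCoeff T = 1 := by
      rw [← PowerSeries.coeff_zero_eq_constantCoeff_apply, cT]; simp [hb0]
    have cW0 : PowerSeries.constantCoeff W = 1 := by
      have := congrArg (PowerSeries.constantCoeff) hTW
      simpa [cT0] using this
    have hWX : W = PowerSeries.X * (PowerSeries.mk fun i => PowerSeries.coeff (i + 1) W) + 1 := by
      have := PowerSeries.eq_X_mul_shift_add_const W
      rwa [cW0, map_one] at this
    have hheq : T * (W ^ p - (PowerSeries.mk fun i => PowerSeries.coeff (i + 1) W) *
        ∑ i ∈ Finset.range p, W ^ i) = h := by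
      have hX : (PowerSeries.X : PowerSeries ℝ) ≠ 0 := PowerSeries.X_ne_zero
      refine mul_left_cancel₀ hX ?_
      rw [← hTf]
      have hg := mul_geom_sum W p
      generalize (∑ i ∈ Finset.range p, W ^ i) = Q at hg ⊢
      generalize (PowerSeries.mk fun i => PowerSeries.coeff (i + 1) W) = w at hWX ⊢
      linear_combination (-T) * hg + T * Q * hWX
    rw [hheq] at eh'
    refine ⟨_, eh'.pos hh hB, ?_⟩
    have e3 := eT.mul eF
    rw [hTf] at e3
    exact e3.unique (SchEv.X.mul eh')
  · refine ⟨∑ i ∈ Finset.range m, (- b (i + 1)) • B ^ i,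
      SchPos.sum fun i _ => (hB.pow i).smul (by have := hneg i; linarith), ?_⟩
    rw [hTB, Finset.sum_range_succ', hb0, pow_zero, one_smul, Finset.mul_sum]
    simp only [neg_smul, mul_neg, mul_smul_comm, ← pow_succ', Finset.sum_neg_distrib]
    abel
end

/-- One step of the Schröder iteration. -/
noncomputable def schStep (p m : ℕ) (b : ℕ → ℝ) {n : ℕ} (B Z : Matrix (Fin n) (Fin n) ℝ) :
    Matrix (Fin n) (Fin n) ℝ :=
  Z * ∑ i ∈ Finset.range (m + 1), (b i • (1 - (1 - B) * (Z ^ p)⁻¹) ^ i)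

lemma sch_commute_inv {n : ℕ} {M Z : Matrix (Fin n) (Fin n) ℝ} (h : Commute M Z) :
    Commute M Z⁻¹ := by
  by_cases hZ : IsUnit Z
  · obtain ⟨u, rfl⟩ := hZ
    rw [← Matrix.coe_units_inv]
    exact h.units_inv_right
  · rw [Matrix.nonsing_inv_eq_ringInverse, Ring.inverse_non_unit _ hZ]
    exact Commute.zero_right M

lemma sch_commute_step (p m : ℕ) (b : ℕ → ℝ) {n : ℕ} {M B Z : Matrix (Fin n) (Fin n) ℝ}
    (hB : Commute M B) (hZ : Commute M Z) : Commute M (schStep p m b B Z) := by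
  unfold schStep
  refine hZ.mul_right (Commute.sum_right _ _ _ fun i _ => Commute.smul_right (Commute.pow_right ?_ _) _)
  exact (Commute.one_right M).sub_right
    (((Commute.one_right M).sub_right hB).mul_right (sch_commute_inv (hZ.pow_right p)))

lemma sch_commute_iter (p m : ℕ) (b : ℕ → ℝ) {n : ℕ} {M B : Matrix (Fin n) (Fin n) ℝ}
    (hB : Commute M B) (k : ℕ) : Commute M ((schStep p m b B)^[k] 1) := by
  induction k with
  | zero => exact Commute.one_right M
  | succ k ih => rw [Function.iterate_succ_apply']; exact sch_commute_step p m b hB ih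

lemma sch_semiconj (p m : ℕ) (b : ℕ → ℝ) {n : ℕ} {B TB FB Z : Matrix (Fin n) (Fin n) ℝ}
    (hFB : FB = 1 - (1 - B) * TB⁻¹ ^ p) (hZ : Commute TB Z) :
    schStep p m b B (TB * Z) = TB * schStep p m b FB Z := by
  have h1 : ((TB * Z) ^ p)⁻¹ = TB⁻¹ ^ p * (Z ^ p)⁻¹ := by
    rw [hZ.mul_pow, (hZ.pow_pow p p).eq, Matrix.mul_inv_rev, Matrix.inv_pow']
  unfold schStep
  rw [h1, hFB, sub_sub_cancel, mul_assoc, mul_assoc]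

lemma sch_iter_succ (p m : ℕ) (b : ℕ → ℝ) {n : ℕ} {B TB FB : Matrix (Fin n) (Fin n) ℝ}
    (hTB : TB = ∑ i ∈ Finset.range (m + 1), b i • B ^ i)
    (hFB : FB = 1 - (1 - B) * TB⁻¹ ^ p) (k : ℕ) :
    (schStep p m b B)^[k + 1] 1 = TB * (schStep p m b FB)^[k] 1 := by
  have hc : Commute TB B := by
    rw [hTB]
    exact Commute.sum_left _ _ _ fun i _ => ((Commute.refl B).pow_left i).smul_left _
  have hcF : Commute TB FB := by
    rw [hFB]
    exact (Commute.one_right TB).sub_right (((Commute.one_right TB).sub_right hc).mul_right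
      ((sch_commute_inv (Commute.refl TB)).pow_right p))
  induction k with
  | zero =>
    simp [schStep, hTB]
  | succ k ih =>
    rw [Function.iterate_succ_apply', ih, sch_semiconj p m b hFB (sch_commute_iter p m b hcF k),
      Function.iterate_succ_apply']

section
attribute [local instance] Matrix.linftyOpNormedRing Matrix.linftyOpNormedAlgebra

lemma sch_main (p m : ℕ) (hp : 2 ≤ p) (hm : 1 ≤ m) (b : ℕ → ℝ)
    (hb : ∀ i, b i = (∏ j ∈ Finset.range i, ((j : ℝ) - 1 / p)) / (Nat.factorial i : ℝ))
    {n : ℕ} (k : ℕ) : ∀ (B : Matrix (Fin n) (Fin n) ℝ), SchPos B → (Summable fun k => ‖B ^ k‖) →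
    (∀ Y, SchPos (Y * B) → SchPos (Y * (1 - (schStep p m b B)^[k] 1))) ∧
    ∃ H, SchPos H ∧ (schStep p m b B)^[k] 1 * H = 1 := by
  induction k with
  | zero =>
    intro B _ _
    refine ⟨fun Y _ => ?_, 1, SchPos.one, by simp⟩
    simp only [Function.iterate_zero, id, sub_self, mul_zero]
    intro i j; simp
  | succ k ih =>
    intro B hB hs
    set TB := ∑ i ∈ Finset.range (m + 1), b i • B ^ i with hTB
    set FB := 1 - (1 - B) * TB⁻¹ ^ p with hFB
    obtain ⟨h1, h2, h3, h4, ⟨h, hh, h5⟩, g, hg, h6⟩ :=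
      sch_matrix_step p m hp hm b hb hB hs hTB rfl hFB
    obtain ⟨i1, H, hH, i2⟩ := ih FB h3 h4
    rw [sch_iter_succ p m b hTB hFB]
    refine ⟨fun Y hY => ?_, H * TB⁻¹, hH.mul h2, ?_⟩
    · have e : Y * (1 - TB * (schStep p m b FB)^[k] 1) =
          Y * B * g + (Y * TB) * (1 - (schStep p m b FB)^[k] 1) := by
        rw [mul_assoc Y B, ← h6]; noncomm_ring
      rw [e]
      refine (hY.mul hg).add (i1 _ ?_)
      rw [mul_assoc, h5, ← mul_assoc]
      exact hY.mul hh
    · rw [mul_assoc, ← mul_assoc _ H, i2, one_mul, h1]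

lemma sch_final (p m : ℕ) (hp : 2 ≤ p) (hm : 1 ≤ m) (b : ℕ → ℝ)
    (hb : ∀ i, b i = (∏ j ∈ Finset.range i, ((j : ℝ) - 1 / p)) / (Nat.factorial i : ℝ))
    {n : ℕ} (k : ℕ) (B : Matrix (Fin n) (Fin n) ℝ) (hB : SchPos B)
    (hρ : spectralRadius ℂ (B.map (Complex.ofReal)) < 1) :
    SchPos (1 - (schStep p m b B)^[k] 1) ∧
    spectralRadius ℂ ((1 - (schStep p m b B)^[k] 1).map (Complex.ofReal)) < 1 := by
  obtain ⟨h1, H, hH, h2⟩ := sch_main p m hp hm b hb k B hB (sch_summable_of_radius hρ)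
  have h3 := h1 1 (by rwa [one_mul])
  rw [one_mul] at h3
  exact ⟨h3, sch_radius_of_summable (sch_summable_of_inv h3 hH (by rwa [sub_sub_cancel]))⟩
end


/-- Structure preservation in 𝓜₁: for every k, C_k = I − X_k has nonnegative entries and
spectral radius ρ(C_k) < 1; in particular each X_k is a nonsingular M-matrix with
diagonal entries in (0,1]. -/
theorem matrix_schroder_M_matrix_preserving
    (p m : ℕ) (hp : 2 ≤ p) (hm : 1 ≤ m)
    (b : ℕ → ℝ)
    (hb : ∀ i, b i = (∏ j ∈ Finset.range i, ((j : ℝ) - 1 / p)) / (Nat.factorial i : ℝ))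
    (n : ℕ) (hn : 1 ≤ n)
    (B : Matrix (Fin n) (Fin n) ℝ)
    (hBpos : ∀ i j, 0 ≤ B i j)
    (hρ : spectralRadius ℂ (B.map (Complex.ofReal)) < 1)
    (A : Matrix (Fin n) (Fin n) ℝ) (hA : A = 1 - B)
    (X : ℕ → Matrix (Fin n) (Fin n) ℝ)
    (hX0 : X 0 = 1)
    (hX : ∀ k, X (k + 1) = X k * ∑ i ∈ Finset.range (m + 1),
      (b i • (1 - A * (X k ^ p)⁻¹) ^ i)) :
    ∀ k, (∀ i j, 0 ≤ (1 - X k) i j) ∧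
      spectralRadius ℂ ((1 - X k).map (Complex.ofReal)) < 1 := by
  have hXk : ∀ k, X k = (schStep p m b B)^[k] 1 := by
    intro k
    induction k with
    | zero => simpa using hX0
    | succ k ih => rw [hX k, Function.iterate_succ_apply', ← ih, hA, schStep]
  intro k
  rw [hXk k]
  exact sch_final p m hp hm b hb k B hBpos hρ
end
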